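/- Let n ≥ 1, 1 < p ≤ q < ∞, 0 < r < ∞, 0 < α ≤ 1, and assume it is NOT the case that (p = q and q > r and α < 1). Let 𝒮 be an η-sparse collection of dyadic cubes in ℝⁿ and let ω, σ be weights on ℝⁿ with [ω]_{A∞} < ∞, [σ]_{A∞} < ∞ and [ω,σ]_{A^α_{pq}(𝒮)} < ∞. Then there is a constant C depending only on n, p, q, r, α, η such that for all f ∈ L^p_σ: ‖A^{r,α}_𝒮(fσ)‖_{L^q_ω} ≤ C · [ω,σ]_{A^α_{pq}(𝒮)} · ( [σ]_{A∞}^{1/q} + [ω]_{A∞}^{(1/r − 1/p)_+} ) · ‖f‖_{L^p_σ}, where x_+ := max(x,0). -/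

import Mathlib

open MeasureTheory ENNReal Set

noncomputable section

/-- An axis-parallel (closed) cube in ℝⁿ with corner `corner` and side length `side > 0`. -/
structure Cube (n : ℕ) where
  corner : Fin n → ℝ
  side : ℝ
  side_pos : 0 < side

namespace Cube

/-- The set of points of the cube. -/
def carrier {n : ℕ} (Q : Cube n) : Set (Fin n → ℝ) :=
  {x | ∀ i, Q.corner i ≤ x i ∧ x i ≤ Q.corner i + Q.side}

/-- The volume `|Q|` of the cube. -/
def vol {n : ℕ} (Q : Cube n) : ℝ := Q.side ^ n

/-- `Q` is a cube of the standard dyadic grid: `Q = 2^{-j}([0,1]^n + m)`. -/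
def IsDyadic {n : ℕ} (Q : Cube n) : Prop :=
  ∃ (j : ℤ) (m : Fin n → ℤ),
    Q.side = (2 : ℝ) ^ (-j) ∧ ∀ i, Q.corner i = (m i : ℝ) * (2 : ℝ) ^ (-j)

end Cube

/-- `η`-sparseness of a collection of cubes: there are pairwise disjoint measurable
subsets `E Q ⊆ Q` with `|E Q| ≥ η |Q|`. -/
def IsSparse {n : ℕ} (η : ℝ) (S : Set (Cube n)) : Prop :=
  ∃ E : Cube n → Set (Fin n → ℝ),
    (∀ Q ∈ S, MeasurableSet (E Q)) ∧ (∀ Q ∈ S, E Q ⊆ Q.carrier) ∧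
    (S.Pairwise (fun Q Q' => Disjoint (E Q) (E Q'))) ∧
    (∀ Q ∈ S, ENNReal.ofReal (η * Q.vol) ≤ volume (E Q))

/-- A weight: a nonnegative locally integrable function on ℝⁿ. -/
def IsWeight {n : ℕ} (w : (Fin n → ℝ) → ℝ) : Prop :=
  MeasureTheory.LocallyIntegrable w volume ∧ ∀ x, 0 ≤ w x

/-- `ω(Q) = ∫_Q ω`. -/
def wMass {n : ℕ} (w : (Fin n → ℝ) → ℝ) (Q : Cube n) : ℝ≥0∞ :=
  ∫⁻ x in Q.carrier, ENNReal.ofReal (w x)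

/-- The weighted `L^s` (quasi)norm `‖f‖_{L^s_w} = (∫ |f|^s w)^{1/s}`, valued in `ℝ≥0∞`. -/
def wNorm {n : ℕ} (s : ℝ) (w f : (Fin n → ℝ) → ℝ) : ℝ≥0∞ :=
  (∫⁻ x, ENNReal.ofReal (|f x| ^ s) * ENNReal.ofReal (w x)) ^ (1 / s)

/-- The weighted `L^s` (quasi)norm of an `ℝ≥0∞`-valued function. -/
def eNorm {n : ℕ} (s : ℝ) (w : (Fin n → ℝ) → ℝ) (g : (Fin n → ℝ) → ℝ≥0∞) : ℝ≥0∞ :=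
  (∫⁻ x, g x ^ s * ENNReal.ofReal (w x)) ^ (1 / s)

/-- `Σ_{Q ∈ D} g(Q) 1_Q`. -/
def cubeSum {n : ℕ} (D : Set (Cube n)) (g : Cube n → ℝ≥0∞) (x : Fin n → ℝ) : ℝ≥0∞ :=
  ∑' Q : D, Q.1.carrier.indicator (fun _ => g Q.1) x

/-- The sparse operator `A^{r,α}_S f = (Σ_{Q∈S} (|Q|^{-α} ∫_Q f)^r 1_Q)^{1/r}`
(for nonnegative `f`; negative values are truncated). -/
def sparseOp {n : ℕ} (S : Set (Cube n)) (r α : ℝ) (f : (Fin n → ℝ) → ℝ)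
    (x : Fin n → ℝ) : ℝ≥0∞ :=
  (cubeSum S
      (fun Q => ((ENNReal.ofReal Q.vol) ^ (-α) * ∫⁻ y in Q.carrier, ENNReal.ofReal (f y)) ^ r)
      x) ^ (1 / r)

/-- The Hardy–Littlewood maximal function over axis-parallel cubes. -/
def maximal {n : ℕ} (w : (Fin n → ℝ) → ℝ) (x : Fin n → ℝ) : ℝ≥0∞ :=
  ⨆ (Q : Cube n) (_ : x ∈ Q.carrier),
    (ENNReal.ofReal Q.vol)⁻¹ * ∫⁻ y in Q.carrier, ENNReal.ofReal |w y|

/-- The Fujii–Wilson `A∞`-characteristic `[w]_{A∞} = sup_Q ω(Q)⁻¹ ∫_Q M(1_Q ω)`. -/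
def AinfChar {n : ℕ} (w : (Fin n → ℝ) → ℝ) : ℝ≥0∞ :=
  ⨆ Q : Cube n, (wMass w Q)⁻¹ * ∫⁻ x in Q.carrier, maximal (Q.carrier.indicator w) x

/-- The two-weight characteristic
`[ω,σ]_{A^α_{pq}(S)} = sup_{Q∈S} |Q|^{-α} ω(Q)^{1/q} σ(Q)^{1/p'}` (here `1/p' = 1 - 1/p`). -/
def twoWeightChar {n : ℕ} (p q α : ℝ) (S : Set (Cube n)) (w σ' : (Fin n → ℝ) → ℝ) : ℝ≥0∞ :=
  ⨆ Q ∈ S, (ENNReal.ofReal Q.vol) ^ (-α) * wMass w Q ^ (1 / q) * wMass σ' Q ^ (1 - 1 / p)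

/-- The one-weight characteristic
`[w]_{A_{pq}} = sup_Q (|Q|⁻¹ ∫_Q w^q)(|Q|⁻¹ ∫_Q w^{-p'})^{q/p'}`, `p' = p/(p-1)`. -/
def ApqChar {n : ℕ} (p q : ℝ) (w : (Fin n → ℝ) → ℝ) : ℝ≥0∞ :=
  ⨆ Q : Cube n,
    ((ENNReal.ofReal Q.vol)⁻¹ * ∫⁻ x in Q.carrier, (ENNReal.ofReal (w x)) ^ q) *
      ((ENNReal.ofReal Q.vol)⁻¹ *
          ∫⁻ x in Q.carrier, (ENNReal.ofReal (w x)) ^ (-(p / (p - 1)))) ^ (q / (p / (p - 1)))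

/-- The testing constant `𝒯`. -/
def testT {n : ℕ} (p q r α : ℝ) (S : Set (Cube n)) (w σ' : (Fin n → ℝ) → ℝ) : ℝ≥0∞ :=
  ⨆ R ∈ S,
    wMass σ' R ^ (-(r / p)) *
      eNorm (q / r) w
        (cubeSum {Q | Q ∈ S ∧ Q.carrier ⊆ R.carrier}
          (fun Q => (ENNReal.ofReal Q.vol) ^ (-(α * r)) * wMass σ' Q ^ r))

/-- The testing constant `𝒯*`; here `1/(q/r)' = 1 - r/q` and `(p/r)' = (p/r)/((p/r)-1)`. -/
def testTstar {n : ℕ} (p q r α : ℝ) (S : Set (Cube n)) (w σ' : (Fin n → ℝ) → ℝ) : ℝ≥0∞ :=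
  ⨆ R ∈ S,
    wMass w R ^ (-(1 - r / q)) *
      eNorm ((p / r) / (p / r - 1)) σ'
        (cubeSum {Q | Q ∈ S ∧ Q.carrier ⊆ R.carrier}
          (fun Q => (ENNReal.ofReal Q.vol) ^ (-(α * r)) * wMass σ' Q ^ (r - 1) * wMass w Q))

/-- The operator (quasi)norm of `A^{r,α}_S(·σ) : L^p_σ → L^q_ω`, i.e. the least constant `K`
with `‖A^{r,α}_S(fσ)‖_{L^q_ω} ≤ K ‖f‖_{L^p_σ}` for all `f`. -/
def sparseOpNorm {n : ℕ} (p q r α : ℝ) (S : Set (Cube n)) (w σ' : (Fin n → ℝ) → ℝ) : ℝ≥0∞ :=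
  sInf {K : ℝ≥0∞ | ∀ f : (Fin n → ℝ) → ℝ, Measurable f →
    eNorm q w (sparseOp S r α (fun y => f y * σ' y)) ≤ K * wNorm p σ' f}

namespace SparseBound

theorem add_rpow_le_rpow_add_mul (x y : ℝ≥0∞) {s : ℝ} (hs : 1 ≤ s) :
    (x + y) ^ s ≤ y ^ s + ENNReal.ofReal s * (x * (x + y) ^ (s - 1)) := by
  have hs0 : 0 < s := by linarith
  have hsne : ENNReal.ofReal s ≠ 0 := by simpa using hs0
  rcases eq_or_ne y ⊤ with rfl | hy
  · simp [ENNReal.top_rpow_of_pos hs0]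
  rcases eq_or_ne x ⊤ with rfl | hx
  · have : (⊤ : ℝ≥0∞) ^ (s - 1) ≠ 0 := by
      rw [Ne, ENNReal.rpow_eq_zero_iff]
      simp
      linarith
    simp [ENNReal.top_mul, ENNReal.mul_top, hsne, this]
  rcases eq_or_ne (x + y) 0 with h0 | h0
  · rw [h0, ENNReal.zero_rpow_of_pos hs0]; exact zero_le
  lift x to NNReal using hx
  lift y to NNReal using hy
  have hz : (0 : ℝ) < (x : ℝ) + y := by
    have : x + y ≠ 0 := by exact_mod_cast h0
    exact_mod_cast pos_iff_ne_zero.2 this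
  have key : ((x : ℝ) + y) ^ s ≤ (y : ℝ) ^ s + s * (x * ((x : ℝ) + y) ^ (s - 1)) := by
    have hb := one_add_mul_self_le_rpow_one_add (s := -(x : ℝ) / (x + y))
      (by rw [le_div_iff₀ hz]; linarith [y.coe_nonneg]) hs
    have h1 : 1 + -(x : ℝ) / (x + y) = y / (x + y) := by field_simp; ring
    rw [h1, Real.div_rpow y.coe_nonneg hz.le, le_div_iff₀ (Real.rpow_pos_of_pos hz s)] at hb
    have h2 : ((x : ℝ) + y) ^ s = (x + y) * ((x : ℝ) + y) ^ (s - 1) := by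
      rw [Real.rpow_sub_one hz.ne']; field_simp
    have h3 : (1 + s * (-(x : ℝ) / (x + y))) * (x + y) ^ s
        = (x + y) ^ s - s * (x * (x + y) ^ (s - 1)) := by
      conv_lhs => rw [h2]
      conv_rhs => rw [h2]
      field_simp
      ring
    linarith
  have e1 : ((x : ℝ≥0∞) + y) ^ s = ENNReal.ofReal (((x : ℝ) + y) ^ s) := by
    rw [← ENNReal.ofReal_rpow_of_pos hz, ENNReal.ofReal_add x.coe_nonneg y.coe_nonneg]; simp
  have e2 : ((x : ℝ≥0∞) + y) ^ (s - 1) = ENNReal.ofReal (((x : ℝ) + y) ^ (s - 1)) := by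
    rw [← ENNReal.ofReal_rpow_of_pos hz, ENNReal.ofReal_add x.coe_nonneg y.coe_nonneg]; simp
  have e3 : (y : ℝ≥0∞) ^ s = ENNReal.ofReal ((y : ℝ) ^ s) := by
    rw [← ENNReal.ofReal_rpow_of_nonneg y.coe_nonneg hs0.le]; simp
  have e4 : (x : ℝ≥0∞) = ENNReal.ofReal x := by simp
  rw [e1, e2, e3, e4, ← ENNReal.ofReal_mul x.coe_nonneg, ← ENNReal.ofReal_mul hs0.le,
    ← ENNReal.ofReal_add (by positivity) (by positivity)]
  exact ENNReal.ofReal_le_ofReal key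

/-- Hölder's inequality for finite sums, with exponents `p + q = 1`. -/
theorem sum_rpow_mul_rpow_le {ι : Type*} (T : Finset ι) (x y : ι → ℝ≥0∞) {p q : ℝ}
    (hp : 0 ≤ p) (hq : 0 ≤ q) (hpq : p + q = 1) :
    ∑ i ∈ T, x i ^ p * y i ^ q ≤ (∑ i ∈ T, x i) ^ p * (∑ i ∈ T, y i) ^ q := by
  let m : MeasurableSpace ι := ⊤
  have := ENNReal.lintegral_mul_norm_pow_le (μ := Measure.count.restrict (T : Set ι))
    (f := x) (g := y) (measurable_from_top.aemeasurable) (measurable_from_top.aemeasurable)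
    hp hq hpq
  have hsum : ∀ h : ι → ℝ≥0∞,
      ∫⁻ i, h i ∂(Measure.count.restrict (T : Set ι)) = ∑ i ∈ T, h i := by
    intro h
    rw [lintegral_finset]
    simp
  simpa [hsum] using this

theorem sum_rpow_le_rpow_sum {ι : Type*} (T : Finset ι) (z : ι → ℝ≥0∞) {κ : ℝ} (hκ : 1 ≤ κ) :
    ∑ i ∈ T, z i ^ κ ≤ (∑ i ∈ T, z i) ^ κ := by
  classical
  induction T using Finset.induction_on with
  | empty => simp
  | insert a T ha ih =>
    rw [Finset.sum_insert ha, Finset.sum_insert ha]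
    exact (by gcongr : _ ≤ z a ^ κ + (∑ i ∈ T, z i) ^ κ).trans (ENNReal.add_rpow_le_rpow_add _ _ hκ)

theorem rpow_sum_le_sum_rpow {ι : Type*} (T : Finset ι) (z : ι → ℝ≥0∞) {κ : ℝ} (h0 : 0 < κ)
    (hκ : κ ≤ 1) : (∑ i ∈ T, z i) ^ κ ≤ ∑ i ∈ T, z i ^ κ := by
  classical
  induction T using Finset.induction_on with
  | empty => simp [h0]
  | insert a T ha ih =>
    rw [Finset.sum_insert ha, Finset.sum_insert ha]
    exact (ENNReal.rpow_add_le_add_rpow _ _ h0.le hκ).trans (by gcongr)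

theorem rpow_le_of_le_mul_rpow {N P : ℝ≥0∞} {τ : ℝ} (hN : N ≠ ⊤) (hτ : 0 < τ)
    (h : N ≤ P * N ^ (1 - τ)) : N ^ τ ≤ P := by
  rcases eq_or_ne N 0 with rfl | h0
  · simp [hτ]
  have hne : N ^ (1 - τ) ≠ 0 := by simp [ENNReal.rpow_eq_zero_iff, h0, hN]
  have hnt : N ^ (1 - τ) ≠ ⊤ := by simp [ENNReal.rpow_eq_top_iff, h0, hN]
  have : N ^ τ * N ^ (1 - τ) ≤ P * N ^ (1 - τ) := by
    rw [← ENNReal.rpow_add _ _ h0 hN]; simpa using h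
  exact (ENNReal.mul_le_mul_iff_left hne hnt).1 this

theorem two_zpow_rpow_eq (k : ℤ) (δ : ℝ) :
    ((2 : ℝ≥0∞) ^ k) ^ δ = (2 : ℝ≥0∞) ^ ((k : ℝ) * δ) := by
  rw [← ENNReal.rpow_intCast, ← ENNReal.rpow_mul]

/-- A geometric sum over distinct powers of two is controlled by its largest term. -/
theorem exists_sum_two_zpow_le {δ : ℝ} (hδ : 0 < δ) :
    ∃ C : ℝ≥0∞, C ≠ ⊤ ∧ ∀ (T : Finset ℤ) (y : ℝ≥0∞), (∀ k ∈ T, (2 : ℝ≥0∞) ^ k ≤ y) →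
      ∑ k ∈ T, ((2 : ℝ≥0∞) ^ k) ^ δ ≤ C * y ^ δ := by
  have hlt : (2 : ℝ≥0∞) ^ (-δ) < 1 :=
    ENNReal.rpow_lt_one_of_one_lt_of_neg (by norm_num) (by linarith)
  refine ⟨(1 - (2 : ℝ≥0∞) ^ (-δ))⁻¹, ?_, ?_⟩
  · simpa [tsub_eq_zero_iff_le] using hlt
  intro T y hT
  rcases T.eq_empty_or_nonempty with rfl | hne
  · simp
  set m := T.max' hne with hm
  have hterm : ∀ k ∈ T, ((2 : ℝ≥0∞) ^ k) ^ δ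
      = ((2 : ℝ≥0∞) ^ m) ^ δ * ((2 : ℝ≥0∞) ^ (-δ)) ^ ((m - k).toNat) := by
    intro k hk
    have hkm : k ≤ m := T.le_max' k hk
    rw [two_zpow_rpow_eq, two_zpow_rpow_eq, ← ENNReal.rpow_natCast, ← ENNReal.rpow_mul,
      ← ENNReal.rpow_add _ _ (by norm_num) (by norm_num)]
    congr 1
    have : ((m - k).toNat : ℝ) = (m : ℝ) - k := by
      have h := Int.toNat_of_nonneg (sub_nonneg.2 hkm)
      have h' : (((m - k).toNat : ℤ) : ℝ) = ((m - k : ℤ) : ℝ) := by rw [h]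
      push_cast at h'
      exact h'
    rw [this]; ring
  rw [Finset.sum_congr rfl hterm, ← Finset.mul_sum, mul_comm]
  have hinj : Set.InjOn (fun k : ℤ => (m - k).toNat) T := by
    intro a ha b hb hab
    have h1 : a ≤ m := T.le_max' a ha
    have h2 : b ≤ m := T.le_max' b hb
    simp only at hab
    omega
  gcongr ?_ * (?_ : ℝ≥0∞) ^ δ
  · rw [← Finset.sum_image (f := fun i : ℕ => ((2 : ℝ≥0∞) ^ (-δ)) ^ i) hinj,
      ← ENNReal.tsum_geometric]
    exact ENNReal.sum_le_tsum _
  · exact hT m (T.max'_mem hne)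

theorem isChain_rpow_sum_le {ι : Type*} [PartialOrder ι] [DecidableLE ι] (x : ι → ℝ≥0∞) {s : ℝ}
    (hs : 1 ≤ s) (T : Finset ι) (hT : ∀ a ∈ T, ∀ b ∈ T, a ≤ b ∨ b ≤ a) :
    (∑ i ∈ T, x i) ^ s ≤
      ENNReal.ofReal s * ∑ i ∈ T, x i * (∑ j ∈ T with j ≤ i, x j) ^ (s - 1) := by
  classical
  induction T using Finset.strongInduction with
  | H T ih =>
    rcases T.eq_empty_or_nonempty with rfl | hne
    · simp [show 0 < s by linarith]
    obtain ⟨m, hmT, hm⟩ := T.exists_maximal hne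
    have hgr : ∀ a ∈ T, a ≤ m := fun a ha => by
      rcases hT a ha m hmT with h | h
      · exact h
      · exact hm ha h
    have hsub : T.erase m ⊂ T := Finset.erase_ssubset hmT
    have ih' := ih _ hsub (fun a ha b hb =>
      hT a (Finset.mem_of_mem_erase ha) b (Finset.mem_of_mem_erase hb))
    rw [← Finset.add_sum_erase T x hmT]
    refine (add_rpow_le_rpow_add_mul _ _ hs).trans ?_
    rw [← Finset.add_sum_erase T (fun i => x i * (∑ j ∈ T with j ≤ i, x j) ^ (s - 1)) hmT,
      mul_add, add_comm]
    have h1 : (∑ j ∈ T with j ≤ m, x j) = x m + ∑ j ∈ T.erase m, x j := by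
      rw [Finset.filter_true_of_mem hgr, Finset.add_sum_erase T x hmT]
    refine add_le_add (by rw [h1]) (ih'.trans ?_)
    gcongr

theorem isChain_rpow_sum_le' {ι : Type*} [PartialOrder ι] [DecidableLE ι] (x : ι → ℝ≥0∞) {s : ℝ}
    (hs : 1 ≤ s) (T : Finset ι) (hT : ∀ a ∈ T, ∀ b ∈ T, a ≤ b ∨ b ≤ a) :
    (∑ i ∈ T, x i) ^ s ≤
      ENNReal.ofReal s * ∑ i ∈ T, x i * (∑ j ∈ T with i ≤ j, x j) ^ (s - 1) :=
  isChain_rpow_sum_le (ι := ιᵒᵈ) x hs T fun a ha b hb => hT b hb a ha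

section Laminar

open Classical

variable {X : Type*} [MeasurableSpace X]

/-- A finite family of measurable sets, any two of which are nested or disjoint. -/
structure IsLaminar (S : Finset (Set X)) : Prop where
  meas : ∀ Q ∈ S, MeasurableSet Q
  nested : ∀ Q ∈ S, ∀ R ∈ S, Q ⊆ R ∨ R ⊆ Q ∨ Disjoint Q R

namespace IsLaminar

variable {S : Finset (Set X)}

theorem mono (hS : IsLaminar S) {T : Finset (Set X)} (h : T ⊆ S) : IsLaminar T :=
  ⟨fun Q hQ => hS.meas Q (h hQ), fun Q hQ R hR => hS.nested Q (h hQ) R (h hR)⟩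

theorem le_or_le (hS : IsLaminar S) {Q R : Set X} (hQ : Q ∈ S) (hR : R ∈ S) {x : X}
    (hxQ : x ∈ Q) (hxR : x ∈ R) : Q ≤ R ∨ R ≤ Q := by
  rcases hS.nested Q hQ R hR with h | h | h
  · exact Or.inl h
  · exact Or.inr h
  · exact (Set.disjoint_left.1 h hxQ hxR).elim

theorem measurable_sum_indicator (hS : IsLaminar S) (a : Set X → ℝ≥0∞) :
    Measurable fun x => ∑ Q ∈ S, Q.indicator (fun _ => a Q) x :=
  Finset.measurable_fun_sum _ fun Q hQ => measurable_const.indicator (hS.meas Q hQ)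

end IsLaminar

omit [MeasurableSpace X] in
theorem sum_indicator_eq (S : Finset (Set X)) (a : Set X → ℝ≥0∞) (x : X) :
    ∑ Q ∈ S, Q.indicator (fun _ => a Q) x = ∑ Q ∈ S with x ∈ Q, a Q := by
  rw [Finset.sum_filter]
  rfl

theorem setLIntegral_rpow_le {μ : Measure X} {h : X → ℝ≥0∞} (hh : Measurable h) (Q : Set X)
    {τ : ℝ} (h0 : 0 ≤ τ) (h1 : τ ≤ 1) :
    ∫⁻ x in Q, h x ^ τ ∂μ ≤ (∫⁻ x in Q, h x ∂μ) ^ τ * μ Q ^ (1 - τ) := by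
  have := ENNReal.lintegral_mul_norm_pow_le (μ := μ.restrict Q) (f := h) (g := fun _ => 1)
    hh.aemeasurable aemeasurable_const h0 (sub_nonneg.2 h1) (by ring)
  simpa using this

theorem lintegral_rpow_sum_le_of_le_two {s : ℝ} (hs : 1 < s) (hs2 : s ≤ 2)
    {S : Finset (Set X)} (hS : IsLaminar S) {μ : Measure X} {c : Set X → ℝ≥0∞}
    (h0 : ∀ Q ∈ S, μ Q ≠ 0) (ht : ∀ Q ∈ S, μ Q ≠ ⊤) :
    ∫⁻ x, (∑ Q ∈ S, Q.indicator (fun _ => c Q / μ Q) x) ^ s ∂μ ≤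
      ENNReal.ofReal s * ∑ Q ∈ S, c Q * ((∑ R ∈ S with R ⊆ Q, c R) / μ Q) ^ (s - 1) := by
  set h : Set X → X → ℝ≥0∞ :=
    fun Q x => ∑ R ∈ S with R ⊆ Q, R.indicator (fun _ => c R / μ R) x with hh
  have hsub : ∀ Q, (S.filter (· ⊆ Q)) ⊆ S := fun Q => Finset.filter_subset _ _
  have hmh : ∀ Q, Measurable (h Q) := fun Q => (hS.mono (hsub Q)).measurable_sum_indicator _
  have hpt : ∀ x, (∑ Q ∈ S, Q.indicator (fun _ => c Q / μ Q) x) ^ s ≤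
      ENNReal.ofReal s *
        ∑ Q ∈ S, Q.indicator (fun x => c Q / μ Q * h Q x ^ (s - 1)) x := by
    intro x
    rw [sum_indicator_eq]
    refine (isChain_rpow_sum_le _ hs.le _ ?_).trans ?_
    · intro a ha b hb
      rw [Finset.mem_filter] at ha hb
      exact hS.le_or_le ha.1 hb.1 ha.2 hb.2
    · rw [Finset.sum_filter]
      gcongr with Q hQ
      by_cases hx : x ∈ Q
      · rw [if_pos hx, Set.indicator_of_mem hx, hh]
        simp only
        rw [sum_indicator_eq, Finset.filter_filter, Finset.filter_filter]
        refine le_of_eq ?_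
        congr 3
        ext R
        simp only [Finset.mem_filter, and_comm]
      · simp [hx]
  refine (lintegral_mono hpt).trans ?_
  rw [lintegral_const_mul' _ _ ENNReal.ofReal_ne_top, lintegral_finsetSum]
  swap
  · intro Q hQ
    exact (((hmh Q).pow_const _).const_mul _).indicator (hS.meas Q hQ)
  gcongr with Q hQ
  rw [lintegral_indicator (hS.meas Q hQ), lintegral_const_mul _ ((hmh Q).pow_const _)]
  have hint : ∫⁻ x in Q, h Q x ∂μ = ∑ R ∈ S with R ⊆ Q, c R := by
    rw [hh]
    simp only
    rw [lintegral_finsetSum]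
    · refine Finset.sum_congr rfl fun R hR => ?_
      rw [Finset.mem_filter] at hR
      rw [lintegral_indicator (hS.meas R hR.1), setLIntegral_const,
        Measure.restrict_apply (hS.meas R hR.1), Set.inter_eq_left.2 hR.2,
        ENNReal.div_mul_cancel (h0 R hR.1) (ht R hR.1)]
    · intro R hR
      exact measurable_const.indicator (hS.meas R (hsub Q hR))
  calc c Q / μ Q * ∫⁻ x in Q, h Q x ^ (s - 1) ∂μ
      ≤ c Q / μ Q * ((∑ R ∈ S with R ⊆ Q, c R) ^ (s - 1) * μ Q ^ (1 - (s - 1))) := by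
        gcongr
        rw [← hint]
        exact setLIntegral_rpow_le (hmh Q) Q (by linarith) (by linarith)
    _ = c Q * ((∑ R ∈ S with R ⊆ Q, c R) / μ Q) ^ (s - 1) := by
        rw [ENNReal.div_rpow_of_nonneg _ _ (by linarith : (0 : ℝ) ≤ s - 1),
          ENNReal.rpow_sub _ _ (h0 Q hQ) (ht Q hQ), ENNReal.rpow_one]
        simp only [div_eq_mul_inv]
        calc _ = c Q * ((∑ R ∈ S with R ⊆ Q, c R) ^ (s - 1) * (μ Q ^ (s - 1))⁻¹)
            * ((μ Q)⁻¹ * μ Q) := by ring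
          _ = _ := by rw [ENNReal.inv_mul_cancel (h0 Q hQ) (ht Q hQ), mul_one]

theorem lintegral_rpow_sum_le_of_two_le {s : ℝ} (hs2 : 2 ≤ s)
    {S : Finset (Set X)} (hS : IsLaminar S) {μ : Measure X} {c : Set X → ℝ≥0∞}
    (h0 : ∀ Q ∈ S, μ Q ≠ 0) (ht : ∀ Q ∈ S, μ Q ≠ ⊤) (hc : ∀ Q ∈ S, c Q ≠ ⊤) :
    ∫⁻ x, (∑ Q ∈ S, Q.indicator (fun _ => c Q / μ Q) x) ^ s ∂μ ≤
      ENNReal.ofReal s * ENNReal.ofReal (s - 1) ^ (s - 1) *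
        ∑ Q ∈ S, c Q * ((∑ R ∈ S with R ⊆ Q, c R) / μ Q) ^ (s - 1) := by
  set U : Set X → ℝ≥0∞ := fun Q => ∑ R ∈ S with Q ≤ R, c R / μ R with hU
  set A : Set X → ℝ≥0∞ := fun Q => (∑ R ∈ S with R ⊆ Q, c R) / μ Q with hA
  set N : ℝ≥0∞ := ∑ Q ∈ S, c Q * U Q ^ (s - 1) with hN
  have hpt : ∀ x, (∑ Q ∈ S, Q.indicator (fun _ => c Q / μ Q) x) ^ s ≤
      ENNReal.ofReal s * ∑ Q ∈ S, Q.indicator (fun _ => c Q / μ Q * U Q ^ (s - 1)) x := by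
    intro x
    rw [sum_indicator_eq, sum_indicator_eq]
    refine (isChain_rpow_sum_le' _ (by linarith) _ ?_).trans ?_
    · intro a ha b hb
      rw [Finset.mem_filter] at ha hb
      exact hS.le_or_le ha.1 hb.1 ha.2 hb.2
    · gcongr with Q hQ
      · linarith
      rw [Finset.filter_filter]
      refine Finset.sum_le_sum_of_subset fun R hR => ?_
      rw [Finset.mem_filter] at hR ⊢
      exact ⟨hR.1, hR.2.2⟩
  have hstep : ∫⁻ x, (∑ Q ∈ S, Q.indicator (fun _ => c Q / μ Q) x) ^ s ∂μ ≤
      ENNReal.ofReal s * N := by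
    refine (lintegral_mono hpt).trans ?_
    rw [lintegral_const_mul' _ _ ENNReal.ofReal_ne_top, lintegral_finsetSum]
    swap
    · intro Q hQ
      exact measurable_const.indicator (hS.meas Q hQ)
    refine mul_le_mul_right (Finset.sum_le_sum fun Q hQ => ?_) _
    rw [lintegral_indicator (hS.meas Q hQ), setLIntegral_const, mul_right_comm,
      ENNReal.div_mul_cancel (h0 Q hQ) (ht Q hQ)]
  have hUt : ∀ Q, U Q ≠ ⊤ := by
    intro Q
    refine (ENNReal.sum_lt_top.2 fun R hR => ?_).ne
    rw [Finset.mem_filter] at hR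
    exact (ENNReal.div_lt_top (hc R hR.1) (h0 R hR.1))
  have hNt : N ≠ ⊤ := by
    refine (ENNReal.sum_lt_top.2 fun Q hQ => ?_).ne
    exact ENNReal.mul_lt_top (hc Q hQ).lt_top
      (ENNReal.rpow_lt_top_of_nonneg (by linarith) (hUt Q))
  have hUpow : ∀ Q ∈ S, U Q ^ (s - 1) ≤
      ENNReal.ofReal (s - 1) * ∑ R ∈ S with Q ⊆ R, c R / μ R * U R ^ (s - 2) := by
    intro Q hQ
    obtain ⟨x, hx⟩ := nonempty_of_measure_ne_zero (h0 Q hQ)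
    refine (isChain_rpow_sum_le' _ (by linarith) _ ?_).trans ?_
    · intro a ha b hb
      rw [Finset.mem_filter] at ha hb
      exact hS.le_or_le ha.1 hb.1 (ha.2 hx) (hb.2 hx)
    · rw [show s - 1 - 1 = s - 2 by ring]
      gcongr with R hR
      rw [Finset.filter_filter]
      refine Finset.sum_le_sum_of_subset fun R hR => ?_
      rw [Finset.mem_filter] at hR ⊢
      exact ⟨hR.1, hR.2.2⟩
  set P : ℝ≥0∞ := ∑ Q ∈ S, c Q * A Q ^ (s - 1) with hP
  have hs1 : 0 < s - 1 := by linarith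
  have hNle : N ≤ ENNReal.ofReal (s - 1) * P ^ (1 / (s - 1)) * N ^ (1 - 1 / (s - 1)) := by
    calc N ≤ ∑ Q ∈ S, c Q * (ENNReal.ofReal (s - 1) *
          ∑ R ∈ S with Q ⊆ R, c R / μ R * U R ^ (s - 2)) := by
          rw [hN]
          gcongr with Q hQ
          exact hUpow Q hQ
      _ = ENNReal.ofReal (s - 1) * ∑ Q ∈ S, ∑ R ∈ S with Q ⊆ R,
            c Q * (c R / μ R * U R ^ (s - 2)) := by
          simp only [Finset.mul_sum]
          refine Finset.sum_congr rfl fun Q _ => Finset.sum_congr rfl fun R _ => by ring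
      _ = ENNReal.ofReal (s - 1) * ∑ R ∈ S, ∑ Q ∈ S with Q ⊆ R,
            c Q * (c R / μ R * U R ^ (s - 2)) := by
          congr 1
          refine Finset.sum_comm' fun Q R => ?_
          simp only [Finset.mem_filter]
          tauto
      _ = ENNReal.ofReal (s - 1) * ∑ R ∈ S,
            (c R * A R ^ (s - 1)) ^ (1 / (s - 1)) *
              (c R * U R ^ (s - 1)) ^ (1 - 1 / (s - 1)) := by
          congr 1
          refine Finset.sum_congr rfl fun R hR => ?_
          rw [← Finset.sum_mul]
          have hτ : 0 ≤ 1 / (s - 1) := by positivity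
          have hτ1 : 0 ≤ 1 - 1 / (s - 1) := by
            rw [sub_nonneg, div_le_one hs1]; linarith
          rw [ENNReal.mul_rpow_of_nonneg _ _ hτ, ENNReal.mul_rpow_of_nonneg _ _ hτ1,
            ← ENNReal.rpow_mul, ← ENNReal.rpow_mul, mul_one_div_cancel hs1.ne', ENNReal.rpow_one,
            show (s - 1) * (1 - 1 / (s - 1)) = s - 2 by field_simp; ring]
          have hcc : c R ^ (1 / (s - 1)) * c R ^ (1 - 1 / (s - 1)) = c R := by
            rw [← ENNReal.rpow_add_of_nonneg _ _ hτ hτ1]; simp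
          calc _ = c R * A R * U R ^ (s - 2) := by
                rw [hA]; simp only [div_eq_mul_inv]; ring
            _ = (c R ^ (1 / (s - 1)) * c R ^ (1 - 1 / (s - 1))) * A R * U R ^ (s - 2) := by
                rw [hcc]
            _ = _ := by ring
      _ ≤ ENNReal.ofReal (s - 1) * (P ^ (1 / (s - 1)) * N ^ (1 - 1 / (s - 1))) := by
          gcongr
          refine sum_rpow_mul_rpow_le S _ _ (by positivity) ?_ (by ring)
          rw [sub_nonneg, div_le_one hs1]; linarith
      _ = _ := by ring
  have hfin := rpow_le_of_le_mul_rpow hNt (by positivity : 0 < 1 / (s - 1)) hNle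
  have hN2 : N ≤ ENNReal.ofReal (s - 1) ^ (s - 1) * P := by
    have := ENNReal.rpow_le_rpow hfin hs1.le
    rwa [← ENNReal.rpow_mul, one_div_mul_cancel hs1.ne', ENNReal.rpow_one,
      ENNReal.mul_rpow_of_nonneg _ _ hs1.le, ← ENNReal.rpow_mul, one_div_mul_cancel hs1.ne',
      ENNReal.rpow_one] at this
  calc _ ≤ ENNReal.ofReal s * N := hstep
    _ ≤ ENNReal.ofReal s * (ENNReal.ofReal (s - 1) ^ (s - 1) * P) := by gcongr
    _ = _ := by ring

/-- An `L^s` norm of a sum over a laminar family is controlled by local averages. -/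
theorem exists_lintegral_rpow_sum_le {s : ℝ} (hs : 1 < s) :
    ∃ C : ℝ≥0∞, C ≠ ⊤ ∧ ∀ (S : Finset (Set X)), IsLaminar S → ∀ (μ : Measure X)
      (c : Set X → ℝ≥0∞), (∀ Q ∈ S, μ Q ≠ 0) → (∀ Q ∈ S, μ Q ≠ ⊤) → (∀ Q ∈ S, c Q ≠ ⊤) →
      ∫⁻ x, (∑ Q ∈ S, Q.indicator (fun _ => c Q / μ Q) x) ^ s ∂μ ≤
        C * ∑ Q ∈ S, c Q * ((∑ R ∈ S with R ⊆ Q, c R) / μ Q) ^ (s - 1) := by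
  rcases le_total s 2 with h2 | h2
  · exact ⟨_, ENNReal.ofReal_ne_top, fun S hS μ c h0 ht _ =>
      lintegral_rpow_sum_le_of_le_two hs h2 hS h0 ht⟩
  · exact ⟨_, ENNReal.mul_ne_top ENNReal.ofReal_ne_top
      (ENNReal.rpow_ne_top_of_nonneg (by linarith) ENNReal.ofReal_ne_top),
      fun S hS μ c h0 ht hc => lintegral_rpow_sum_le_of_two_le h2 hS h0 ht hc⟩

end Laminar

section Principal

open Classical

variable {X : Type*} [MeasurableSpace X]

/-- `π Q` is the largest set of `S` containing `Q` on which the running maximum of `m` from above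
has the same dyadic size `2 ^ k Q` as on `Q`. -/
structure IsPrincipal (S : Finset (Set X)) (m : Set X → ℝ≥0∞) (π : Set X → Set X)
    (k : Set X → ℤ) : Prop where
  mem : ∀ Q ∈ S, π Q ∈ S
  subset : ∀ Q ∈ S, Q ⊆ π Q
  level : ∀ Q ∈ S, k (π Q) = k Q
  le : ∀ Q ∈ S, m Q ≤ 2 * 2 ^ k Q
  lt : ∀ Q ∈ S, 2 ^ k (π Q) < m (π Q)
  maximal : ∀ Q ∈ S, ∀ R ∈ S, Q ⊆ R → k R = k Q → R ⊆ π Q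
  anti : ∀ Q ∈ S, ∀ R ∈ S, Q ⊆ R → k R ≤ k Q

theorem IsLaminar.exists_isPrincipal {S : Finset (Set X)} (hS : IsLaminar S)
    (hne : ∀ Q ∈ S, Q.Nonempty) {m : Set X → ℝ≥0∞} (h0 : ∀ Q ∈ S, m Q ≠ 0)
    (ht : ∀ Q ∈ S, m Q ≠ ⊤) : ∃ π k, IsPrincipal S m π k := by
  set M : Set X → ℝ≥0∞ := fun Q => (S.filter (Q ⊆ ·)).sup m with hM
  have hle : ∀ Q ∈ S, ∀ R ∈ S, Q ⊆ R → m R ≤ M Q := fun Q _ R hR h =>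
    Finset.le_sup (f := m) (Finset.mem_filter.2 ⟨hR, h⟩)
  have hM0 : ∀ Q ∈ S, M Q ≠ 0 := fun Q hQ h =>
    h0 Q hQ (le_antisymm (h ▸ hle Q hQ Q hQ subset_rfl) zero_le)
  have hatt : ∀ Q ∈ S, ∃ R ∈ S, Q ⊆ R ∧ M Q = m R := by
    intro Q hQ
    obtain ⟨R, hR, h⟩ := Finset.exists_mem_eq_sup (S.filter (Q ⊆ ·))
      ⟨Q, Finset.mem_filter.2 ⟨hQ, subset_rfl⟩⟩ m
    rw [Finset.mem_filter] at hR
    exact ⟨R, hR.1, hR.2, h⟩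
  have hMt : ∀ Q ∈ S, M Q ≠ ⊤ := by
    intro Q hQ
    obtain ⟨R, hR, -, h⟩ := hatt Q hQ
    rw [h]
    exact ht R hR
  have hanti : ∀ Q ∈ S, ∀ R ∈ S, Q ⊆ R → M R ≤ M Q := by
    intro Q hQ R hR h
    refine Finset.sup_mono fun A hA => ?_
    rw [Finset.mem_filter] at hA ⊢
    exact ⟨hA.1, h.trans hA.2⟩
  have hk : ∀ Q : Set X, ∃ k : ℤ, Q ∈ S → M Q ∈ Ioc ((2 : ℝ≥0∞) ^ k) (2 ^ (k + 1)) := by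
    intro Q
    by_cases hQ : Q ∈ S
    · obtain ⟨k, hk⟩ := ENNReal.exists_mem_Ioc_zpow (hM0 Q hQ) (hMt Q hQ)
        (by norm_num : (1 : ℝ≥0∞) < 2) (by norm_num)
      exact ⟨k, fun _ => hk⟩
    · exact ⟨0, fun h => absurd h hQ⟩
  choose k hk using hk
  have hlevel : ∀ Q ∈ S, ∀ R ∈ S, M R ≤ M Q → k R ≤ k Q := by
    intro Q hQ R hR h
    by_contra! hlt
    have h1 : (2 : ℝ≥0∞) ^ (k Q + 1) ≤ 2 ^ k R :=
      ENNReal.zpow_le_of_le (by norm_num) (by omega)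
    exact absurd (((hk R hR).1.trans_le h).trans_le ((hk Q hQ).2.trans h1)) (lt_irrefl _)
  have hmax : ∀ Q : Set X, ∃ F : Set X, Q ∈ S → F ∈ S ∧ Q ⊆ F ∧ k F = k Q ∧
      ∀ R ∈ S, Q ⊆ R → k R = k Q → R ⊆ F := by
    intro Q
    by_cases hQ : Q ∈ S
    · obtain ⟨F, hF, hFm⟩ := (S.filter fun R => Q ⊆ R ∧ k R = k Q).exists_maximal
        ⟨Q, Finset.mem_filter.2 ⟨hQ, subset_rfl, rfl⟩⟩
      rw [Finset.mem_filter] at hF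
      refine ⟨F, fun _ => ⟨hF.1, hF.2.1, hF.2.2, fun R hR h1 h2 => ?_⟩⟩
      obtain ⟨x, hx⟩ := hne Q hQ
      rcases hS.le_or_le hR hF.1 (h1 hx) (hF.2.1 hx) with h | h
      · exact h
      · exact hFm (Finset.mem_filter.2 ⟨hR, h1, h2⟩) h
    · exact ⟨∅, fun h => absurd h hQ⟩
  choose π hπ using hmax
  refine ⟨π, k, fun Q hQ => (hπ Q hQ).1, fun Q hQ => (hπ Q hQ).2.1, fun Q hQ => (hπ Q hQ).2.2.1,
    ?_, ?_, ?_, fun Q hQ R hR h => hlevel Q hQ R hR (hanti Q hQ R hR h)⟩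
  · intro Q hQ
    have := (hle Q hQ Q hQ subset_rfl).trans (hk Q hQ).2
    rwa [ENNReal.zpow_add (by norm_num) (by norm_num), zpow_one, mul_comm] at this
  · intro Q hQ
    obtain ⟨hF, hQF, hkF, hF'⟩ := hπ Q hQ
    obtain ⟨R, hR, hFR, hMR⟩ := hatt _ hF
    have h1 : M R = M (π Q) :=
      le_antisymm (hanti _ hF R hR hFR) (hMR ▸ hle R hR R hR subset_rfl)
    have h2 : k R = k (π Q) :=
      le_antisymm (hlevel _ hF R hR h1.le) (hlevel R hR _ hF h1.ge)
    have h3 : R = π Q := (hF' R hR (hQF.trans hFR) (h2.trans hkF)).antisymm hFR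
    rw [h3] at hMR
    exact hMR ▸ (hk _ hF).1
  · exact fun Q hQ => (hπ Q hQ).2.2.2

namespace IsPrincipal

variable {S : Finset (Set X)} {m : Set X → ℝ≥0∞} {π : Set X → Set X} {k : Set X → ℤ}

omit [MeasurableSpace X] in
theorem between (h : IsPrincipal S m π k) {Q G : Set X} (hQ : Q ∈ S) (hG : G ∈ S) (hQG : Q ⊆ G)
    (hGF : G ⊆ π Q) : π G = π Q := by
  have hkG : k G = k Q :=
    le_antisymm (h.anti Q hQ G hG hQG) (h.level Q hQ ▸ h.anti G hG _ (h.mem Q hQ) hGF)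
  exact (h.maximal Q hQ _ (h.mem G hG) (hQG.trans (h.subset G hG))
    ((h.level G hG).trans hkG)).antisymm
      (h.maximal G hG _ (h.mem Q hQ) hGF ((h.level Q hQ).trans hkG.symm))

omit [MeasurableSpace X] in
theorem proj_eq (h : IsPrincipal S m π k) {F : Set X} (hF : F ∈ S.image π) : π F = F := by
  obtain ⟨Q, hQ, rfl⟩ := Finset.mem_image.1 hF
  exact h.between hQ (h.mem Q hQ) (h.subset Q hQ) subset_rfl

omit [MeasurableSpace X] in
theorem image_subset (h : IsPrincipal S m π k) : S.image π ⊆ S := by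
  intro F hF
  obtain ⟨Q, hQ, rfl⟩ := Finset.mem_image.1 hF
  exact h.mem Q hQ

omit [MeasurableSpace X] in
theorem lt_of_mem (h : IsPrincipal S m π k) {F : Set X} (hF : F ∈ S.image π) : 2 ^ k F < m F := by
  have := h.lt F (h.image_subset hF)
  rwa [h.proj_eq hF] at this

theorem injOn (h : IsPrincipal S m π k) (hS : IsLaminar S) (x : X) :
    Set.InjOn k {F | F ∈ S.image π ∧ x ∈ F} := by
  rintro F ⟨hF, hxF⟩ G ⟨hG, hxG⟩ hk
  have hF' := h.image_subset hF
  have hG' := h.image_subset hG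
  have h1 := h.proj_eq hF
  have h2 := h.proj_eq hG
  rcases hS.le_or_le hF' hG' hxF hxG with hle | hle
  · exact Set.Subset.antisymm hle (h1 ▸ h.maximal F hF' G hG' hle hk.symm)
  · exact Set.Subset.antisymm (h2 ▸ h.maximal G hG' F hF' hle hk) hle

end IsPrincipal

omit [MeasurableSpace X] in
theorem exists_sum_level_le {δ : ℝ} (hδ : 0 < δ) :
    ∃ C : ℝ≥0∞, C ≠ ⊤ ∧ ∀ (T : Finset (Set X)) (k : Set X → ℤ) (y : ℝ≥0∞), Set.InjOn k T →
      (∀ F ∈ T, (2 : ℝ≥0∞) ^ k F ≤ y) → ∑ F ∈ T, ((2 : ℝ≥0∞) ^ k F) ^ δ ≤ C * y ^ δ := by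
  obtain ⟨C, hC, h⟩ := exists_sum_two_zpow_le hδ
  refine ⟨C, hC, fun T k y hk hy => ?_⟩
  rw [← Finset.sum_image (f := fun j : ℤ => ((2 : ℝ≥0∞) ^ j) ^ δ) hk]
  exact h _ _ (by simpa using hy)

theorem mul_rpow_sub_one (x : ℝ≥0∞) {p : ℝ} (hp : 1 ≤ p) : x * x ^ (p - 1) = x ^ p := by
  conv_lhs => rw [← ENNReal.rpow_one x, ← ENNReal.rpow_mul]
  rw [← ENNReal.rpow_add_of_nonneg _ _ zero_le_one (by linarith)]
  congr 1
  ring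

/-- The sum of level powers over principal sets is controlled by the `L^p` norm. -/
theorem exists_sum_principal_le {p : ℝ} (hp : 1 < p) :
    ∃ C : ℝ≥0∞, C ≠ ⊤ ∧ ∀ (S : Finset (Set X)), IsLaminar S → ∀ (σ : Measure X),
      (∀ Q ∈ S, σ Q ≠ 0) → (∀ Q ∈ S, σ Q ≠ ⊤) → ∀ f : X → ℝ≥0∞, Measurable f →
      ∀ π k, IsPrincipal S (fun Q => (∫⁻ x in Q, f x ∂σ) / σ Q) π k →
      ∑ F ∈ S.image π, ((2 : ℝ≥0∞) ^ k F) ^ p * σ F ≤ C * ∫⁻ x, f x ^ p ∂σ := by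
  obtain ⟨C, hC, hgeo⟩ := exists_sum_level_le (X := X) (sub_pos.2 hp)
  refine ⟨2 * (C * 2 ^ (p - 1)), by finiteness, fun S hS σ h0 ht f hf π k h => ?_⟩
  have hp1 : 0 < p - 1 := sub_pos.2 hp
  have hterm : ∀ F ∈ S.image π, ((2 : ℝ≥0∞) ^ k F) ^ p * σ F ≤
      ∫⁻ x, F.indicator (fun x => {x | 2 ^ k F < 2 * f x}.indicator
        (fun x => 2 * (((2 : ℝ≥0∞) ^ k F) ^ (p - 1) * f x)) x) x ∂σ := by
    intro F hF
    have hFS := h.image_subset hF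
    have hFm := hS.meas F hFS
    set b : ℝ≥0∞ := 2 ^ k F with hb
    have hbt : b ≠ ⊤ := ENNReal.zpow_ne_top (by norm_num) (by norm_num) _
    set E : Set X := {x | b < 2 * f x} with hE
    have hEm : MeasurableSet E := measurableSet_lt measurable_const (hf.const_mul 2)
    have h1 : b * σ F ≤ ∫⁻ x in F, f x ∂σ := by
      have := (h.lt_of_mem hF).le
      rwa [ENNReal.le_div_iff_mul_le (Or.inl (h0 F hFS)) (Or.inl (ht F hFS))] at this
    have h2 : 2 * ∫⁻ x in F, f x ∂σ ≤ 2 * ∫⁻ x in F, E.indicator f x ∂σ + b * σ F := by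
      calc 2 * ∫⁻ x in F, f x ∂σ = ∫⁻ x in F, 2 * f x ∂σ := (lintegral_const_mul _ hf).symm
        _ ≤ ∫⁻ x in F, (2 * E.indicator f x + b) ∂σ := by
          refine lintegral_mono fun x => ?_
          by_cases hx : x ∈ E
          · simp [hx]
          · simpa [hx] using not_lt.1 hx
        _ = _ := by
          rw [lintegral_add_right _ measurable_const, lintegral_const_mul _ (hf.indicator hEm),
            setLIntegral_const]
    have h3 : b * σ F ≤ 2 * ∫⁻ x in F, E.indicator f x ∂σ := by
      have hfin : b * σ F ≠ ⊤ := ENNReal.mul_ne_top hbt (ht F hFS)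
      have : b * σ F + b * σ F ≤ 2 * ∫⁻ x in F, E.indicator f x ∂σ + b * σ F :=
        (by rw [two_mul]; gcongr : b * σ F + b * σ F ≤ 2 * ∫⁻ x in F, f x ∂σ).trans h2
      exact (ENNReal.add_le_add_iff_right hfin).1 this
    calc b ^ p * σ F = b ^ (p - 1) * (b * σ F) := by rw [← mul_rpow_sub_one b hp.le]; ring
      _ ≤ b ^ (p - 1) * (2 * ∫⁻ x in F, E.indicator f x ∂σ) := by gcongr
      _ = ∫⁻ x in F, 2 * (b ^ (p - 1) * E.indicator f x) ∂σ := by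
        rw [lintegral_const_mul _ ((hf.indicator hEm).const_mul _),
          lintegral_const_mul _ (hf.indicator hEm)]
        ring
      _ = _ := by
        rw [← lintegral_indicator hFm]
        refine lintegral_congr fun x => ?_
        by_cases hx : x ∈ F <;> by_cases hxE : x ∈ E <;> simp [hx, hxE]
  refine (Finset.sum_le_sum hterm).trans ?_
  rw [← lintegral_finsetSum, ← lintegral_const_mul]
  · refine lintegral_mono fun x => ?_
    set T := (S.image π).filter fun F => x ∈ F ∧ (2 : ℝ≥0∞) ^ k F < 2 * f x with hT
    have : ∑ F ∈ S.image π, F.indicator (fun x => {x | 2 ^ k F < 2 * f x}.indicator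
        (fun x => 2 * (((2 : ℝ≥0∞) ^ k F) ^ (p - 1) * f x)) x) x
        = 2 * f x * ∑ F ∈ T, ((2 : ℝ≥0∞) ^ k F) ^ (p - 1) := by
      rw [hT, Finset.sum_filter, Finset.mul_sum]
      refine Finset.sum_congr rfl fun F _ => ?_
      by_cases hx : x ∈ F <;> by_cases hxE : (2 : ℝ≥0∞) ^ k F < 2 * f x <;> simp [hx, hxE]
      ring
    rw [this]
    have hg := hgeo T k (2 * f x)
      ((h.injOn hS x).mono fun F hF => by
        have := Finset.mem_coe.1 hF
        rw [hT, Finset.mem_filter] at this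
        exact ⟨this.1, this.2.1⟩)
      (fun F hF => by
        rw [hT, Finset.mem_filter] at hF
        exact hF.2.2.le)
    calc 2 * f x * ∑ F ∈ T, ((2 : ℝ≥0∞) ^ k F) ^ (p - 1)
        ≤ 2 * f x * (C * (2 * f x) ^ (p - 1)) := by gcongr
      _ = 2 * (C * 2 ^ (p - 1)) * (f x * f x ^ (p - 1)) := by
        rw [ENNReal.mul_rpow_of_nonneg _ _ hp1.le]; ring
      _ = _ := by rw [mul_rpow_sub_one _ hp.le]
  · exact hf.pow_const _
  · intro F hF
    refine Measurable.indicator ?_ (hS.meas F (h.image_subset hF))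
    exact Measurable.indicator (by fun_prop) (measurableSet_lt measurable_const (hf.const_mul 2))

end Principal

/-- The exponential as a map into `ℝ≥0∞`. -/
def eexp (y : ℝ) : ℝ≥0∞ := ENNReal.ofReal (Real.exp y)

theorem exists_eexp_eq {x : ℝ≥0∞} (h0 : x ≠ 0) (ht : x ≠ ⊤) : ∃ y, x = eexp y :=
  ⟨Real.log x.toReal, by rw [eexp, Real.exp_log (ENNReal.toReal_pos h0 ht), ENNReal.ofReal_toReal ht]⟩

theorem eexp_ne_zero (y : ℝ) : eexp y ≠ 0 := by simp [eexp, Real.exp_pos]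

theorem eexp_ne_top (y : ℝ) : eexp y ≠ ⊤ := ENNReal.ofReal_ne_top

theorem eexp_mul (x y : ℝ) : eexp x * eexp y = eexp (x + y) := by
  rw [eexp, eexp, eexp, Real.exp_add, ENNReal.ofReal_mul (Real.exp_pos _).le]

theorem eexp_rpow (x a : ℝ) : eexp x ^ a = eexp (x * a) := by
  rw [eexp, eexp, ENNReal.ofReal_rpow_of_pos (Real.exp_pos _), Real.exp_mul]

theorem eexp_inv (x : ℝ) : (eexp x)⁻¹ = eexp (-x) := by
  rw [eexp, eexp, ← ENNReal.ofReal_inv_of_pos (Real.exp_pos _), Real.exp_neg]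

theorem eexp_div (x y : ℝ) : eexp x / eexp y = eexp (x - y) := by
  rw [div_eq_mul_inv, eexp_inv, eexp_mul, sub_eq_add_neg]

theorem eexp_le {x y : ℝ} : eexp x ≤ eexp y ↔ x ≤ y := by
  rw [eexp, eexp, ENNReal.ofReal_le_ofReal_iff (Real.exp_pos _).le, Real.exp_le_exp]

theorem two_eq_eexp : (2 : ℝ≥0∞) = eexp (Real.log 2) := by
  rw [eexp, Real.exp_log (by norm_num)]
  simp

theorem two_zpow_eq_eexp (k : ℤ) : (2 : ℝ≥0∞) ^ k = eexp (Real.log 2 * k) := by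
  rw [← ENNReal.rpow_intCast, two_eq_eexp, eexp_rpow]

section Carleson

open Classical

variable {X : Type*} [MeasurableSpace X]

omit [MeasurableSpace X] in
/-- A Carleson condition self-improves to powers at least one. -/
theorem sum_rpow_le_of_sum_le {T : Finset (Set X)} {a : Set X → ℝ≥0∞} {Λ y : ℝ≥0∞} {κ : ℝ}
    (hκ : 1 ≤ κ) (hle : ∀ Q ∈ T, a Q ≤ y) (h : ∑ Q ∈ T, a Q ≤ Λ * y) :
    ∑ Q ∈ T, a Q ^ κ ≤ Λ * y ^ κ := by
  calc ∑ Q ∈ T, a Q ^ κ = ∑ Q ∈ T, a Q * a Q ^ (κ - 1) := by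
        simp_rw [mul_rpow_sub_one _ hκ]
    _ ≤ ∑ Q ∈ T, a Q * y ^ (κ - 1) := by
        gcongr with Q hQ
        exact hle Q hQ
    _ = (∑ Q ∈ T, a Q) * y ^ (κ - 1) := by rw [Finset.sum_mul]
    _ ≤ Λ * y * y ^ (κ - 1) := by gcongr
    _ = _ := by rw [mul_assoc, mul_rpow_sub_one _ hκ]

/-- A geometric sum over a laminar family, weighted by a measure. -/
theorem exists_sum_geometric_le {a : ℝ} (ha : 0 < a) :
    ∃ C : ℝ≥0∞, C ≠ ⊤ ∧ ∀ (S : Finset (Set X)), IsLaminar S → ∀ (σ : Measure X) (k : Set X → ℤ),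
      ∀ T ⊆ S, ∀ R, MeasurableSet R → (∀ Q ∈ T, Q ⊆ R) → (∀ x, Set.InjOn k {Q | Q ∈ T ∧ x ∈ Q}) →
      ∀ y : ℝ≥0∞, (∀ Q ∈ T, (2 : ℝ≥0∞) ^ k Q ≤ y) →
      ∑ Q ∈ T, ((2 : ℝ≥0∞) ^ k Q) ^ a * σ Q ≤ C * y ^ a * σ R := by
  obtain ⟨C, hC, hgeo⟩ := exists_sum_level_le (X := X) ha
  refine ⟨C, hC, fun S hS σ k T hTS R hR hTR hinj y hy => ?_⟩
  have hT := hS.mono hTS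
  calc ∑ Q ∈ T, ((2 : ℝ≥0∞) ^ k Q) ^ a * σ Q
      = ∫⁻ x in R, ∑ Q ∈ T, Q.indicator (fun _ => ((2 : ℝ≥0∞) ^ k Q) ^ a) x ∂σ := by
        rw [lintegral_finsetSum _ fun Q hQ => measurable_const.indicator (hT.meas Q hQ)]
        refine Finset.sum_congr rfl fun Q hQ => ?_
        rw [lintegral_indicator (hT.meas Q hQ), setLIntegral_const,
          Measure.restrict_apply (hT.meas Q hQ), Set.inter_eq_left.2 (hTR Q hQ)]
    _ ≤ ∫⁻ x in R, C * y ^ a ∂σ := by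
        refine lintegral_mono fun x => ?_
        simp only
        rw [sum_indicator_eq]
        refine hgeo _ k y ((hinj x).mono fun Q hQ => ?_) fun Q hQ => ?_
        · simpa using hQ
        · exact hy Q (Finset.mem_filter.1 hQ).1
    _ = _ := setLIntegral_const _ _

/-- Kolmogorov's inequality over a Carleson family: if the measures `v Q` are summable over the
family then so are the quantities `v Q * (σ Q / v Q) ^ δ` for `δ < 1`. -/
theorem exists_sum_kolmogorov_le {δ : ℝ} (h0 : 0 < δ) (h1 : δ < 1) :
    ∃ C : ℝ≥0∞, C ≠ ⊤ ∧ ∀ (S : Finset (Set X)), IsLaminar S → ∀ (σ v : Measure X) (Λ : ℝ≥0∞),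
      (∀ Q ∈ S, σ Q ≠ 0) → (∀ Q ∈ S, σ Q ≠ ⊤) → (∀ Q ∈ S, v Q ≠ 0) → (∀ Q ∈ S, v Q ≠ ⊤) →
      (∀ R ∈ S, ∑ Q ∈ S with Q ⊆ R, v Q ≤ Λ * v R) →
      ∀ R ∈ S, ∑ Q ∈ S with Q ⊆ R, σ Q ^ δ * v Q ^ (1 - δ) ≤ C * Λ * (σ R ^ δ * v R ^ (1 - δ)) := by
  obtain ⟨C, hC, hgeo⟩ := exists_sum_geometric_le (X := X) (sub_pos.2 h1)
  refine ⟨2 ^ δ * C * 2 ^ (1 - δ), by finiteness, fun S hS σ v Λ hσ0 hσt hv0 hvt hΛ R hR => ?_⟩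
  set T := S.filter (· ⊆ R) with hT
  have hTS : T ⊆ S := Finset.filter_subset _ _
  have hRT : R ∈ T := Finset.mem_filter.2 ⟨hR, subset_rfl⟩
  have hTL := hS.mono hTS
  obtain ⟨π, k, h⟩ := hTL.exists_isPrincipal (m := fun Q => σ Q / v Q)
    (fun Q hQ => nonempty_of_measure_ne_zero (hσ0 Q (hTS hQ)))
    (fun Q hQ => (ENNReal.div_pos (hσ0 Q (hTS hQ)) (hvt Q (hTS hQ))).ne')
    (fun Q hQ => (ENNReal.div_lt_top (hσt Q (hTS hQ)) (hv0 Q (hTS hQ))).ne)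
  have key : ∀ Q ∈ T, σ Q ^ δ * v Q ^ (1 - δ) ≤ 2 ^ δ * (((2 : ℝ≥0∞) ^ k (π Q)) ^ δ * v Q) := by
    intro Q hQ
    have := ENNReal.rpow_le_rpow (h.le Q hQ) h0.le
    rw [ENNReal.mul_rpow_of_nonneg _ _ h0.le, ← h.level Q hQ] at this
    calc σ Q ^ δ * v Q ^ (1 - δ) = (σ Q / v Q) ^ δ * v Q := by
          obtain ⟨x, hx⟩ := exists_eexp_eq (hσ0 Q (hTS hQ)) (hσt Q (hTS hQ))
          obtain ⟨y, hy⟩ := exists_eexp_eq (hv0 Q (hTS hQ)) (hvt Q (hTS hQ))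
          simp only [hx, hy, eexp_rpow, eexp_mul, eexp_div]
          congr 1
          ring
      _ ≤ 2 ^ δ * ((2 : ℝ≥0∞) ^ k (π Q)) ^ δ * v Q := by gcongr
      _ = _ := by ring
  have hpr : ∀ F ∈ T.image π, ((2 : ℝ≥0∞) ^ k F) ^ δ * v F ≤
      ((2 : ℝ≥0∞) ^ (-k F)) ^ (1 - δ) * σ F := by
    intro F hF
    have hFS := hTS (h.image_subset hF)
    have := (h.lt_of_mem hF).le
    obtain ⟨x, hx⟩ := exists_eexp_eq (hσ0 F hFS) (hσt F hFS)
    obtain ⟨y, hy⟩ := exists_eexp_eq (hv0 F hFS) (hvt F hFS)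
    simp only [hx, hy, two_zpow_eq_eexp, eexp_rpow, eexp_mul, eexp_div, eexp_le] at this ⊢
    push_cast
    linarith
  have hk2 : (2 : ℝ≥0∞) ^ (-k R) ≤ 2 * (v R / σ R) := by
    have := h.le R hRT
    obtain ⟨x, hx⟩ := exists_eexp_eq (hσ0 R hR) (hσt R hR)
    obtain ⟨y, hy⟩ := exists_eexp_eq (hv0 R hR) (hvt R hR)
    rw [two_zpow_eq_eexp, two_eq_eexp, hx, hy, eexp_div, eexp_mul, eexp_le] at this ⊢
    push_cast
    linarith
  calc ∑ Q ∈ T, σ Q ^ δ * v Q ^ (1 - δ)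
      ≤ ∑ Q ∈ T, 2 ^ δ * (((2 : ℝ≥0∞) ^ k (π Q)) ^ δ * v Q) := Finset.sum_le_sum key
    _ = 2 ^ δ * ∑ F ∈ T.image π, ∑ Q ∈ T with π Q = F, ((2 : ℝ≥0∞) ^ k F) ^ δ * v Q := by
        rw [← Finset.mul_sum]
        congr 1
        rw [← Finset.sum_fiberwise_of_maps_to (t := T.image π) (g := π)
          (fun Q hQ => Finset.mem_image_of_mem π hQ)]
        refine Finset.sum_congr rfl fun F _ => Finset.sum_congr rfl fun Q hQ => ?_
        rw [(Finset.mem_filter.1 hQ).2]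
    _ ≤ 2 ^ δ * ∑ F ∈ T.image π, ((2 : ℝ≥0∞) ^ k F) ^ δ * (Λ * v F) := by
        gcongr with F hF
        rw [← Finset.mul_sum]
        gcongr
        refine le_trans (Finset.sum_le_sum_of_subset fun Q hQ => ?_)
          (hΛ F (hTS (h.image_subset hF)))
        rw [Finset.mem_filter] at hQ ⊢
        exact ⟨hTS hQ.1, hQ.2 ▸ h.subset Q hQ.1⟩
    _ = 2 ^ δ * Λ * ∑ F ∈ T.image π, ((2 : ℝ≥0∞) ^ k F) ^ δ * v F := by
        rw [mul_assoc, Finset.mul_sum, Finset.mul_sum, Finset.mul_sum]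
        exact Finset.sum_congr rfl fun F _ => by ring
    _ ≤ 2 ^ δ * Λ * ∑ F ∈ T.image π, ((2 : ℝ≥0∞) ^ (-k F)) ^ (1 - δ) * σ F := by
        exact mul_le_mul_right (Finset.sum_le_sum hpr) _
    _ ≤ 2 ^ δ * Λ * (C * ((2 : ℝ≥0∞) ^ (-k R)) ^ (1 - δ) * σ R) := by
        gcongr
        refine hgeo T hTL σ (fun F => -k F) _ h.image_subset R (hS.meas R hR)
          (fun F hF => (Finset.mem_filter.1 (h.image_subset hF)).2)
          (fun x F hF G hG hFG => h.injOn hTL x hF hG (neg_injective hFG)) _ fun F hF => ?_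
        refine ENNReal.zpow_le_of_le (by norm_num) (neg_le_neg ?_)
        exact h.anti F (h.image_subset hF) R hRT (Finset.mem_filter.1 (h.image_subset hF)).2
    _ ≤ 2 ^ δ * Λ * (C * (2 * (v R / σ R)) ^ (1 - δ) * σ R) := by
        gcongr
    _ = 2 ^ δ * Λ * C * 2 ^ (1 - δ) * ((v R / σ R) ^ (1 - δ) * σ R) := by
        rw [ENNReal.mul_rpow_of_nonneg _ _ (sub_pos.2 h1).le]
        ring
    _ = 2 ^ δ * Λ * C * 2 ^ (1 - δ) * (σ R ^ δ * v R ^ (1 - δ)) := by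
        congr 1
        obtain ⟨x, hx⟩ := exists_eexp_eq (hσ0 R hR) (hσt R hR)
        obtain ⟨y, hy⟩ := exists_eexp_eq (hv0 R hR) (hvt R hR)
        simp only [hx, hy, eexp_rpow, eexp_mul, eexp_div]
        congr 1
        ring
    _ = _ := by ring

end Carleson

section Testing

open Classical

variable {X : Type*} [MeasurableSpace X]

/-- A measure that is positive and finite on the sets of a family and satisfies a Carleson
condition on it. -/
structure IsCarleson (S : Finset (Set X)) (μ : Measure X) (Λ : ℝ≥0∞) : Prop where
  ne_zero : ∀ Q ∈ S, μ Q ≠ 0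
  ne_top : ∀ Q ∈ S, μ Q ≠ ⊤
  sum_le : ∀ R ∈ S, ∑ Q ∈ S with Q ⊆ R, μ Q ≤ Λ * μ R

/-- A laminar family with scales `k`, in which the measure `v` behaves like volume in
dimension `n`. -/
structure IsScaled (S : Finset (Set X)) (k : Set X → ℤ) (n : ℝ) (v : Measure X) : Prop where
  laminar : IsLaminar S
  vol : ∀ Q ∈ S, v Q = ((2 : ℝ≥0∞) ^ k Q) ^ n
  injOn : ∀ x, Set.InjOn k {Q | Q ∈ S ∧ x ∈ Q}
  mono : ∀ Q ∈ S, ∀ R ∈ S, Q ⊆ R → k Q ≤ k R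

theorem exists_sum_prod_le_of_one_le {n a b c : ℝ} (hn : 0 < n) (ha : 0 < a) (hc : 0 ≤ c)
    (hc1 : c ≤ 1) (hbc : 1 ≤ b + c) :
    ∃ C : ℝ≥0∞, C ≠ ⊤ ∧ ∀ (S : Finset (Set X)) (k : Set X → ℤ) (v σ ω : Measure X),
      IsScaled S k n v → (∀ Q ∈ S, σ Q ≠ 0) → (∀ Q ∈ S, σ Q ≠ ⊤) → (∀ Q ∈ S, ω Q ≠ 0) →
      (∀ Q ∈ S, ω Q ≠ ⊤) → ∀ R ∈ S,
      ∑ Q ∈ S with Q ⊆ R, v Q ^ a * σ Q ^ b * ω Q ^ c ≤ C * (v R ^ a * σ R ^ b * ω R ^ c) := by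
  obtain ⟨C, hC, hgeo⟩ := exists_sum_geometric_le (X := X) (mul_pos hn ha)
  refine ⟨C, hC, fun S k v σ ω hS hσ0 hσt hω0 hωt R hR => ?_⟩
  have hv : ∀ Q ∈ S, v Q ^ a = ((2 : ℝ≥0∞) ^ k Q) ^ (n * a) := fun Q hQ => by
    rw [hS.vol Q hQ, ENNReal.rpow_mul]
  have hb : 0 ≤ 1 - c := by linarith
  have hgeo' : ∀ μ : Measure X, ∑ Q ∈ S with Q ⊆ R, v Q ^ a * μ Q ≤ C * v R ^ a * μ R := by
    intro μ
    rw [hv R hR]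
    refine le_trans (le_of_eq (Finset.sum_congr rfl fun Q hQ => ?_))
      (hgeo S hS.laminar μ k _ (Finset.filter_subset _ _) R (hS.laminar.meas R hR)
        (fun Q hQ => (Finset.mem_filter.1 hQ).2)
        (fun x A hA B hB hAB => hS.injOn x ⟨(Finset.mem_filter.1 hA.1).1, hA.2⟩
          ⟨(Finset.mem_filter.1 hB.1).1, hB.2⟩ hAB) _
        fun Q hQ => ENNReal.zpow_le_of_le (by norm_num)
          (hS.mono Q (Finset.mem_filter.1 hQ).1 R hR (Finset.mem_filter.1 hQ).2))
    rw [hv Q (Finset.mem_filter.1 hQ).1]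
  calc ∑ Q ∈ S with Q ⊆ R, v Q ^ a * σ Q ^ b * ω Q ^ c
      ≤ ∑ Q ∈ S with Q ⊆ R, σ R ^ (b + c - 1) *
          ((v Q ^ a * σ Q) ^ (1 - c) * (v Q ^ a * ω Q) ^ c) := by
        refine Finset.sum_le_sum fun Q hQ => ?_
        rw [Finset.mem_filter] at hQ
        have h1 : v Q ^ a ≠ 0 := by
          rw [hv Q hQ.1, two_zpow_eq_eexp, eexp_rpow]; exact eexp_ne_zero _
        have h2 : v Q ^ a ≠ ⊤ := by
          rw [hv Q hQ.1, two_zpow_eq_eexp, eexp_rpow]; exact eexp_ne_top _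
        calc v Q ^ a * σ Q ^ b * ω Q ^ c
            = σ Q ^ (b + c - 1) * ((v Q ^ a * σ Q) ^ (1 - c) * (v Q ^ a * ω Q) ^ c) := by
              obtain ⟨x, hx⟩ := exists_eexp_eq h1 h2
              obtain ⟨y, hy⟩ := exists_eexp_eq (hσ0 Q hQ.1) (hσt Q hQ.1)
              obtain ⟨z, hz⟩ := exists_eexp_eq (hω0 Q hQ.1) (hωt Q hQ.1)
              simp only [hx, hy, hz, eexp_rpow, eexp_mul]
              congr 1
              ring
          _ ≤ _ := mul_le_mul_left
              (ENNReal.rpow_le_rpow (measure_mono hQ.2) (by linarith)) _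
    _ ≤ σ R ^ (b + c - 1) * ((∑ Q ∈ S with Q ⊆ R, v Q ^ a * σ Q) ^ (1 - c) *
          (∑ Q ∈ S with Q ⊆ R, v Q ^ a * ω Q) ^ c) := by
        rw [← Finset.mul_sum]
        exact mul_le_mul_right (sum_rpow_mul_rpow_le _ _ _ hb hc (by ring)) _
    _ ≤ σ R ^ (b + c - 1) * ((C * v R ^ a * σ R) ^ (1 - c) * (C * v R ^ a * ω R) ^ c) := by
        gcongr
        exacts [hgeo' σ, hgeo' ω]
    _ = (C ^ (1 - c) * C ^ c) * (σ R ^ (b + c - 1) *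
          ((v R ^ a * σ R) ^ (1 - c) * (v R ^ a * ω R) ^ c)) := by
        rw [mul_assoc, mul_assoc, ENNReal.mul_rpow_of_nonneg C _ hb,
          ENNReal.mul_rpow_of_nonneg C _ hc]
        ring
    _ = _ := by
        rw [← ENNReal.rpow_add_of_nonneg _ _ hb hc, sub_add_cancel, ENNReal.rpow_one]
        congr 1
        have h1 : v R ^ a ≠ 0 := by
          rw [hv R hR, two_zpow_eq_eexp, eexp_rpow]; exact eexp_ne_zero _
        have h2 : v R ^ a ≠ ⊤ := by
          rw [hv R hR, two_zpow_eq_eexp, eexp_rpow]; exact eexp_ne_top _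
        obtain ⟨x, hx⟩ := exists_eexp_eq h1 h2
        obtain ⟨y, hy⟩ := exists_eexp_eq (hσ0 R hR) (hσt R hR)
        obtain ⟨z, hz⟩ := exists_eexp_eq (hω0 R hR) (hωt R hR)
        simp only [hx, hy, hz, eexp_rpow, eexp_mul]
        congr 1
        ring

theorem exists_sum_prod_le_of_add_eq_one {a b c : ℝ} (ha : 0 < a) (hb : 0 < b) (hc : 0 < c)
    (habc : a + b + c = 1) (Λ : ℝ≥0∞) (hΛ : Λ ≠ ⊤) :
    ∃ C : ℝ≥0∞, C ≠ ⊤ ∧ ∀ (S : Finset (Set X)) (v σ ω : Measure X),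
      IsLaminar S → IsCarleson S v Λ → (∀ Q ∈ S, σ Q ≠ 0) → (∀ Q ∈ S, σ Q ≠ ⊤) →
      (∀ Q ∈ S, ω Q ≠ 0) → (∀ Q ∈ S, ω Q ≠ ⊤) → ∀ R ∈ S,
      ∑ Q ∈ S with Q ⊆ R, v Q ^ a * σ Q ^ b * ω Q ^ c ≤ C * (v R ^ a * σ R ^ b * ω R ^ c) := by
  set δ := b + c with hδ
  have hδ0 : 0 < δ := by positivity
  have hδ1 : δ < 1 := by linarith
  obtain ⟨C, hC, hkol⟩ := exists_sum_kolmogorov_le (X := X) hδ0 hδ1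
  refine ⟨C * Λ, by finiteness, fun S v σ ω hS hv hσ0 hσt hω0 hωt R hR => ?_⟩
  have hbδ : 0 ≤ b / δ := by positivity
  have hcδ : 0 ≤ c / δ := by positivity
  have h1 : b / δ + c / δ = 1 := by rw [← add_div, ← hδ, div_self hδ0.ne']
  have heq : ∀ Q ∈ S, v Q ^ a * σ Q ^ b * ω Q ^ c =
      (σ Q ^ δ * v Q ^ (1 - δ)) ^ (b / δ) * (ω Q ^ δ * v Q ^ (1 - δ)) ^ (c / δ) := by
    intro Q hQ
    obtain ⟨x, hx⟩ := exists_eexp_eq (hv.ne_zero Q hQ) (hv.ne_top Q hQ)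
    obtain ⟨y, hy⟩ := exists_eexp_eq (hσ0 Q hQ) (hσt Q hQ)
    obtain ⟨z, hz⟩ := exists_eexp_eq (hω0 Q hQ) (hωt Q hQ)
    simp only [hx, hy, hz, eexp_rpow, eexp_mul]
    congr 1
    have ha' : a = 1 - δ := by linarith
    have e1 : δ * (b / δ) = b := mul_div_cancel₀ _ hδ0.ne'
    have e2 : δ * (c / δ) = c := mul_div_cancel₀ _ hδ0.ne'
    linear_combination (-y) * e1 - z * e2 - x * (1 - δ) * h1 + x * ha'
  calc ∑ Q ∈ S with Q ⊆ R, v Q ^ a * σ Q ^ b * ω Q ^ c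
      = ∑ Q ∈ S with Q ⊆ R, (σ Q ^ δ * v Q ^ (1 - δ)) ^ (b / δ) *
          (ω Q ^ δ * v Q ^ (1 - δ)) ^ (c / δ) :=
        Finset.sum_congr rfl fun Q hQ => heq Q (Finset.mem_filter.1 hQ).1
    _ ≤ (∑ Q ∈ S with Q ⊆ R, σ Q ^ δ * v Q ^ (1 - δ)) ^ (b / δ) *
          (∑ Q ∈ S with Q ⊆ R, ω Q ^ δ * v Q ^ (1 - δ)) ^ (c / δ) :=
        sum_rpow_mul_rpow_le _ _ _ hbδ hcδ h1
    _ ≤ (C * Λ * (σ R ^ δ * v R ^ (1 - δ))) ^ (b / δ) *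
          (C * Λ * (ω R ^ δ * v R ^ (1 - δ))) ^ (c / δ) := by
        gcongr
        · exact hkol S hS σ v Λ hσ0 hσt hv.ne_zero hv.ne_top hv.sum_le R hR
        · exact hkol S hS ω v Λ hω0 hωt hv.ne_zero hv.ne_top hv.sum_le R hR
    _ = ((C * Λ) ^ (b / δ) * (C * Λ) ^ (c / δ)) * ((σ R ^ δ * v R ^ (1 - δ)) ^ (b / δ) *
          (ω R ^ δ * v R ^ (1 - δ)) ^ (c / δ)) := by
        rw [ENNReal.mul_rpow_of_nonneg (C * Λ) _ hbδ, ENNReal.mul_rpow_of_nonneg (C * Λ) _ hcδ]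
        ring
    _ = _ := by
        rw [← ENNReal.rpow_add_of_nonneg _ _ hbδ hcδ, h1, ENNReal.rpow_one, heq R hR]

/-- The two-weight setting: a scaled laminar family on which volume `v` and the measures `σ`, `ω`
satisfy Carleson conditions, and whose two-weight characteristic is bounded by `K`. -/
structure IsTwoWeight (p q α n : ℝ) (S : Finset (Set X)) (k : Set X → ℤ) (v σ ω : Measure X)
    (Λ Λσ Λω K : ℝ≥0∞) : Prop where
  scaled : IsScaled S k n v
  vol : IsCarleson S v Λ
  left : IsCarleson S σ Λσ
  right : IsCarleson S ω Λω
  ne_top : K ≠ ⊤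
  le : ∀ Q ∈ S, v Q ^ (-α) * ω Q ^ (1 / q) * σ Q ^ (1 - 1 / p) ≤ K

namespace IsTwoWeight

variable {p q α n : ℝ} {S : Finset (Set X)} {k : Set X → ℤ} {v σ ω : Measure X}
  {Λ Λσ Λω K : ℝ≥0∞}

theorem exists_log (h : IsTwoWeight p q α n S k v σ ω Λ Λσ Λω K) {Q : Set X} (hQ : Q ∈ S) :
    ∃ x y z w : ℝ, v Q = eexp x ∧ σ Q = eexp y ∧ ω Q = eexp z ∧ K = eexp w ∧
      -α * x + z / q + (1 - 1 / p) * y ≤ w := by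
  obtain ⟨x, hx⟩ := exists_eexp_eq (h.vol.ne_zero Q hQ) (h.vol.ne_top Q hQ)
  obtain ⟨y, hy⟩ := exists_eexp_eq (h.left.ne_zero Q hQ) (h.left.ne_top Q hQ)
  obtain ⟨z, hz⟩ := exists_eexp_eq (h.right.ne_zero Q hQ) (h.right.ne_top Q hQ)
  have := h.le Q hQ
  simp only [hx, hy, hz, eexp_rpow, eexp_mul] at this
  have hK : K ≠ 0 := fun h0 => eexp_ne_zero _ (le_antisymm (h0 ▸ this) zero_le)
  obtain ⟨w, rfl⟩ := exists_eexp_eq hK h.ne_top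
  rw [eexp_le] at this
  exact ⟨x, y, z, w, hx, hy, hz, rfl, by linarith [show z / q = z * (1 / q) by ring]⟩

end IsTwoWeight

/-- The sums of the local quantities over descendants are controlled by a single product. -/
theorem exists_sum_le_prod {p q r α n θ : ℝ} {Λ : ℝ≥0∞} (hn : 0 < n) (hα : 0 < α) (hΛ : Λ ≠ ⊤)
    (hr : 0 < r) (hq : 0 < q) (hrθ : r < θ) (hθq : θ < q) (hθp : θ * (1 - 1 / p) < r)
    (h : θ * (1 - 1 / p + 1 / q) ≤ r ∨ p = q ∧ α = 1) :
    ∃ C : ℝ≥0∞, C ≠ ⊤ ∧ ∀ (S : Finset (Set X)) (k : Set X → ℤ) (v σ ω : Measure X)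
      (Λσ Λω K : ℝ≥0∞), IsTwoWeight p q α n S k v σ ω Λ Λσ Λω K → ∀ R ∈ S,
      ∑ Q ∈ S with Q ⊆ R, v Q ^ (-(α * r)) * σ Q ^ r * ω Q ≤
        C * (K ^ θ * (v R ^ (α * (θ - r)) * σ R ^ (r - θ * (1 - 1 / p)) * ω R ^ (1 - θ / q))) := by
  have hc : 0 < 1 - θ / q := by rw [sub_pos, div_lt_one hq]; exact hθq
  suffices H : ∃ C : ℝ≥0∞, C ≠ ⊤ ∧ ∀ (S : Finset (Set X)) (k : Set X → ℤ) (v σ ω : Measure X)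
      (Λσ Λω K : ℝ≥0∞), IsTwoWeight p q α n S k v σ ω Λ Λσ Λω K → ∀ R ∈ S,
      ∑ Q ∈ S with Q ⊆ R,
          v Q ^ (α * (θ - r)) * σ Q ^ (r - θ * (1 - 1 / p)) * ω Q ^ (1 - θ / q) ≤
        C * (v R ^ (α * (θ - r)) * σ R ^ (r - θ * (1 - 1 / p)) * ω R ^ (1 - θ / q)) by
    obtain ⟨C, hC, H⟩ := H
    refine ⟨C, hC, fun S k v σ ω Λσ Λω K hK R hR => ?_⟩
    calc ∑ Q ∈ S with Q ⊆ R, v Q ^ (-(α * r)) * σ Q ^ r * ω Q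
        ≤ ∑ Q ∈ S with Q ⊆ R, K ^ θ *
          (v Q ^ (α * (θ - r)) * σ Q ^ (r - θ * (1 - 1 / p)) * ω Q ^ (1 - θ / q)) := by
          refine Finset.sum_le_sum fun Q hQ => ?_
          obtain ⟨x, y, z, w, hx, hy, hz, rfl, hle⟩ := hK.exists_log (Finset.mem_filter.1 hQ).1
          simp only [hx, hy, hz, eexp_rpow, eexp_mul, eexp_le]
          have hθ : 0 ≤ θ := by linarith
          have := mul_le_mul_of_nonneg_left hle hθ
          linarith [show θ * (z / q) = z * (θ / q) by ring]
      _ ≤ K ^ θ * (C * (v R ^ (α * (θ - r)) * σ R ^ (r - θ * (1 - 1 / p)) *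
            ω R ^ (1 - θ / q))) := by
          rw [← Finset.mul_sum]
          exact mul_le_mul_right (H S k v σ ω Λσ Λω K hK R hR) _
      _ = _ := by ring
  rcases h with h | ⟨rfl, rfl⟩
  · obtain ⟨C, hC, H⟩ := exists_sum_prod_le_of_one_le (X := X) (n := n) (a := α * (θ - r))
      (b := r - θ * (1 - 1 / p)) (c := 1 - θ / q) hn (mul_pos hα (sub_pos.2 hrθ)) hc.le
      (sub_le_self _ (div_nonneg (by linarith) hq.le))
      (by linarith [show θ * (1 - 1 / p + 1 / q) = θ * (1 - 1 / p) + θ / q by ring])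
    exact ⟨C, hC, fun S k v σ ω Λσ Λω K hK R hR => H S k v σ ω hK.scaled hK.left.ne_zero
      hK.left.ne_top hK.right.ne_zero hK.right.ne_top R hR⟩
  · obtain ⟨C, hC, H⟩ := exists_sum_prod_le_of_add_eq_one (X := X) (a := 1 * (θ - r))
      (b := r - θ * (1 - 1 / p)) (c := 1 - θ / p) (by linarith) (by linarith) hc
      (by ring) Λ hΛ
    exact ⟨C, hC, fun S k v σ ω Λσ Λω K hK R hR => H S v σ ω hK.scaled.laminar hK.vol
      hK.left.ne_zero hK.left.ne_top hK.right.ne_zero hK.right.ne_top R hR⟩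

/-- The inequalities between exponents under which the local sums can be estimated. -/
structure IsExponent (p q r α θ : ℝ) : Prop where
  lt : r < θ
  lt_right : θ < q
  mul_lt : θ * (1 - 1 / p) < r
  mul_le : θ * (q / r - 1) ≤ q
  le_left : r < p → θ ≤ p
  cases : θ * (1 - 1 / p + 1 / q) ≤ r ∨ p = q ∧ α = 1

theorem exists_isExponent {p q r α : ℝ} (hp : 1 < p) (hpq : p ≤ q) (hr : 0 < r) (hrq : r < q)
    (h : p < q ∨ α = 1) : ∃ θ, IsExponent p q r α θ := by
  have hp0 : 0 < p := by linarith
  have hq0 : 0 < q := by linarith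
  have h1p : 0 < 1 - 1 / p := by rw [sub_pos, div_lt_one hp0]; exact hp
  have hqr : 0 < q / r - 1 := by rw [sub_pos, one_lt_div hr]; exact hrq
  obtain ⟨a, ha, hau⟩ : ∃ a, r < a ∧ (a * (1 - 1 / p + 1 / q) ≤ r ∨ p = q ∧ α = 1) := by
    rcases hpq.lt_or_eq with hlt | heq
    · have hu : 0 < 1 - 1 / p + 1 / q := by positivity
      have hu1 : 1 - 1 / p + 1 / q < 1 := by linarith [one_div_lt_one_div_of_lt hp0 hlt]
      refine ⟨r / (1 - 1 / p + 1 / q), ?_, Or.inl (div_mul_cancel₀ _ hu.ne').le⟩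
      rw [lt_div_iff₀ hu]
      nlinarith
    · exact ⟨r + 1, by linarith, Or.inr ⟨heq, h.resolve_left heq.not_lt⟩⟩
  obtain ⟨b, hb, hbp⟩ : ∃ b, r < b ∧ (r < p → b ≤ p) := by
    rcases lt_or_ge r p with hlt | hge
    · exact ⟨p, hlt, fun _ => le_rfl⟩
    · exact ⟨r + 1, by linarith, fun h => absurd h hge.not_gt⟩
  have h1 : r < r / (1 - 1 / p) := by
    rw [lt_div_iff₀ h1p]
    have : 0 < 1 / p := by positivity
    nlinarith
  have h2 : r < q / (q / r - 1) := by
    rw [lt_div_iff₀ hqr, mul_sub, mul_div_cancel₀ _ hr.ne']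
    linarith
  obtain ⟨θ, hθ, hθ'⟩ := exists_between
    (lt_min hrq (lt_min h1 (lt_min h2 (lt_min ha hb))))
  simp only [lt_min_iff] at hθ'
  obtain ⟨t1, t2, t3, t4, t5⟩ := hθ'
  refine ⟨θ, hθ, t1, (lt_div_iff₀ h1p).1 t2, ((lt_div_iff₀ hqr).1 t3).le,
    fun hrp => t5.le.trans (hbp hrp), hau.imp_left fun hle => le_trans ?_ hle⟩
  have : 0 < 1 - 1 / p + 1 / q := by positivity
  gcongr

/-- A testing estimate: if the local sums are controlled by `D`, and `D` satisfies a pointwise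
bound by powers of a Carleson measure `ν`, then local norms are controlled by `ν`. -/
theorem exists_testing_le {s κ : ℝ} (hs : 1 < s) (hκ : 1 ≤ κ) :
    ∃ C : ℝ≥0∞, C ≠ ⊤ ∧ ∀ (S : Finset (Set X)), IsLaminar S → ∀ (μ ν : Measure X)
      (c D : Set X → ℝ≥0∞) (L Λ : ℝ≥0∞), (∀ Q ∈ S, μ Q ≠ 0) → (∀ Q ∈ S, μ Q ≠ ⊤) →
      (∀ Q ∈ S, c Q ≠ ⊤) → IsCarleson S ν Λ → ∀ B : ℝ≥0∞,
      (∀ R ∈ S, ∑ Q ∈ S with Q ⊆ R, c Q ≤ B * D R) →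
      (∀ Q ∈ S, c Q * (D Q / μ Q) ^ (s - 1) ≤ L * ν Q ^ κ) → ∀ R ∈ S,
      ∫⁻ x, (∑ Q ∈ S with Q ⊆ R, Q.indicator (fun _ => c Q / μ Q) x) ^ s ∂μ ≤
        C * B ^ (s - 1) * L * Λ * ν R ^ κ := by
  obtain ⟨C, hC, H⟩ := exists_lintegral_rpow_sum_le (X := X) hs
  refine ⟨C, hC, fun S hS μ ν c D L Λ h0 ht hc hν B hB hL R hR => ?_⟩
  have hs1 : 0 ≤ s - 1 := by linarith
  set T := S.filter (· ⊆ R) with hT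
  have hTS : T ⊆ S := Finset.filter_subset _ _
  calc _ ≤ C * ∑ Q ∈ T, c Q * ((∑ A ∈ T with A ⊆ Q, c A) / μ Q) ^ (s - 1) :=
        H T (hS.mono hTS) μ c (fun Q hQ => h0 Q (hTS hQ)) (fun Q hQ => ht Q (hTS hQ))
          (fun Q hQ => hc Q (hTS hQ))
    _ ≤ C * ∑ Q ∈ T, B ^ (s - 1) * (L * ν Q ^ κ) := by
        refine mul_le_mul_right (Finset.sum_le_sum fun Q hQ => ?_) _
        have hle : ∑ A ∈ T with A ⊆ Q, c A ≤ B * D Q := by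
          refine le_trans (Finset.sum_le_sum_of_subset fun A hA => ?_) (hB Q (hTS hQ))
          rw [Finset.mem_filter] at hA ⊢
          exact ⟨hTS hA.1, hA.2⟩
        calc _ ≤ c Q * ((B * D Q) / μ Q) ^ (s - 1) := by gcongr
          _ = B ^ (s - 1) * (c Q * (D Q / μ Q) ^ (s - 1)) := by
              rw [mul_div_assoc, ENNReal.mul_rpow_of_nonneg _ _ hs1]
              ring
          _ ≤ _ := mul_le_mul_right (hL Q (hTS hQ)) _
    _ = C * B ^ (s - 1) * L * ∑ Q ∈ T, ν Q ^ κ := by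
        rw [← Finset.mul_sum, ← Finset.mul_sum]
        ring
    _ ≤ C * B ^ (s - 1) * L * (Λ * ν R ^ κ) := by
        gcongr
        exact sum_rpow_le_of_sum_le hκ
          (fun Q hQ => measure_mono (Finset.mem_filter.1 hQ).2) (hν.sum_le R hR)
    _ = _ := by ring

/-- The direct testing condition. -/
theorem exists_testing {p q r α n θ : ℝ} {Λ : ℝ≥0∞} (hn : 0 < n) (hα : 0 < α) (hΛ : Λ ≠ ⊤)
    (hp : 1 < p) (hpq : p ≤ q) (hr : 0 < r) (hrq : r < q) (hθ : IsExponent p q r α θ) :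
    ∃ C : ℝ≥0∞, C ≠ ⊤ ∧ ∀ (S : Finset (Set X)) (k : Set X → ℤ) (v σ ω : Measure X)
      (Λσ Λω K : ℝ≥0∞), IsTwoWeight p q α n S k v σ ω Λ Λσ Λω K → ∀ R ∈ S,
      ∫⁻ x, (∑ Q ∈ S with Q ⊆ R, Q.indicator (fun _ => (v Q ^ (-α) * σ Q) ^ r) x) ^ (q / r) ∂ω ≤
        C * K ^ q * Λσ * σ R ^ (q / p) := by
  have hq0 : 0 < q := by linarith
  have hp0 : 0 < p := by linarith
  obtain ⟨B, hB, hsum⟩ := exists_sum_le_prod (X := X) hn hα hΛ hr hq0 hθ.lt hθ.lt_right hθ.mul_lt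
    hθ.cases
  have hs : 1 < q / r := (one_lt_div hr).2 hrq
  obtain ⟨C, hC, H⟩ := exists_testing_le (X := X) hs ((one_le_div hp0).2 hpq)
  have hs1 : 0 ≤ q / r - 1 := by linarith
  refine ⟨C * B ^ (q / r - 1), by finiteness, fun S k v σ ω Λσ Λω K h R hR => ?_⟩
  refine le_trans (le_of_eq (lintegral_congr fun x => ?_)) (H S h.scaled.laminar ω σ
    (fun Q => v Q ^ (-(α * r)) * σ Q ^ r * ω Q) (fun Q => K ^ θ *
      (v Q ^ (α * (θ - r)) * σ Q ^ (r - θ * (1 - 1 / p)) * ω Q ^ (1 - θ / q))) (K ^ q) Λσ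
    h.right.ne_zero h.right.ne_top (fun Q hQ => ?_) h.left B
    (hsum S k v σ ω Λσ Λω K h) (fun Q hQ => ?_) R hR)
  · congr 1
    refine Finset.sum_congr rfl fun Q hQ => ?_
    obtain ⟨x, y, z, w, hx, hy, hz, rfl, hle⟩ := h.exists_log (Finset.mem_filter.1 hQ).1
    simp only [hx, hy, hz, eexp_rpow, eexp_mul, eexp_div]
    congr! 3
    ring
  · obtain ⟨x, y, z, w, hx, hy, hz, rfl, hle⟩ := h.exists_log hQ
    simp only [hx, hy, hz, eexp_rpow, eexp_mul]
    exact eexp_ne_top _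
  · obtain ⟨x, y, z, w, hx, hy, hz, rfl, hle⟩ := h.exists_log hQ
    simp only [hx, hy, hz, eexp_rpow, eexp_mul, eexp_div, eexp_le]
    have := mul_le_mul_of_nonneg_left hle (sub_nonneg.2 hθ.mul_le)
    have e1 : r * (q / r) = q := mul_div_cancel₀ _ hr.ne'
    refine sub_nonneg.1 (le_of_le_of_eq (sub_nonneg.2 this) ?_)
    field_simp
    ring

/-- The dual testing condition. -/
theorem exists_testing_dual {p q r α n θ : ℝ} {Λ : ℝ≥0∞} (hn : 0 < n) (hα : 0 < α) (hΛ : Λ ≠ ⊤)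
    (hp : 1 < p) (hpq : p ≤ q) (hr : 0 < r) (hrp : r < p) (hθ : IsExponent p q r α θ) :
    ∃ C : ℝ≥0∞, C ≠ ⊤ ∧ ∀ (S : Finset (Set X)) (k : Set X → ℤ) (v σ ω : Measure X)
      (Λσ Λω K : ℝ≥0∞), IsTwoWeight p q α n S k v σ ω Λ Λσ Λω K → ∀ R ∈ S,
      ∫⁻ x, (∑ Q ∈ S with Q ⊆ R, Q.indicator
          (fun _ => (v Q ^ (-α) * σ Q) ^ r * ω Q / σ Q) x) ^ (p / (p - r)) ∂σ ≤
        C * K ^ (r * (p / (p - r))) * Λω * ω R ^ (p / (p - r) * (1 - r / q)) := by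
  have hq0 : 0 < q := by linarith
  have hp0 : 0 < p := by linarith
  have hpr : 0 < p - r := by linarith
  obtain ⟨B, hB, hsum⟩ := exists_sum_le_prod (X := X) hn hα hΛ hr hq0 hθ.lt hθ.lt_right hθ.mul_lt
    hθ.cases
  have hs : 1 < p / (p - r) := (one_lt_div hpr).2 (by linarith)
  have hκ : 1 ≤ p / (p - r) * (1 - r / q) := by
    have : r / q ≤ r / p := div_le_div_of_nonneg_left hr.le hp0 hpq
    calc 1 = p / (p - r) * (1 - r / p) := by field_simp
      _ ≤ _ := by gcongr
  obtain ⟨C, hC, H⟩ := exists_testing_le (X := X) hs hκ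
  have hs1 : 0 ≤ p / (p - r) - 1 := by linarith
  refine ⟨C * B ^ (p / (p - r) - 1), by finiteness, fun S k v σ ω Λσ Λω K h R hR => ?_⟩
  refine le_trans (le_of_eq (lintegral_congr fun x => ?_)) (H S h.scaled.laminar σ ω
    (fun Q => v Q ^ (-(α * r)) * σ Q ^ r * ω Q) (fun Q => K ^ θ *
      (v Q ^ (α * (θ - r)) * σ Q ^ (r - θ * (1 - 1 / p)) * ω Q ^ (1 - θ / q)))
    (K ^ (r * (p / (p - r)))) Λω
    h.left.ne_zero h.left.ne_top (fun Q hQ => ?_) h.right B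
    (hsum S k v σ ω Λσ Λω K h) (fun Q hQ => ?_) R hR)
  · congr 1
    refine Finset.sum_congr rfl fun Q hQ => ?_
    obtain ⟨x, y, z, w, hx, hy, hz, rfl, hle⟩ := h.exists_log (Finset.mem_filter.1 hQ).1
    simp only [hx, hy, hz, eexp_rpow, eexp_mul, eexp_div]
    congr! 3
    ring
  · obtain ⟨x, y, z, w, hx, hy, hz, rfl, hle⟩ := h.exists_log hQ
    simp only [hx, hy, hz, eexp_rpow, eexp_mul]
    exact eexp_ne_top _
  · obtain ⟨x, y, z, w, hx, hy, hz, rfl, hle⟩ := h.exists_log hQ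
    simp only [hx, hy, hz, eexp_rpow, eexp_mul, eexp_div, eexp_le]
    have hnn : 0 ≤ r * (p / (p - r)) - θ * (p / (p - r) - 1) := by
      have : r * (p / (p - r)) - θ * (p / (p - r) - 1) = (p - θ) * (r / (p - r)) := by
        field_simp
        ring
      rw [this]
      exact mul_nonneg (sub_nonneg.2 (hθ.le_left hrp)) (by positivity)
    have := mul_le_mul_of_nonneg_left hle hnn
    refine sub_nonneg.1 (le_of_le_of_eq (sub_nonneg.2 this) ?_)
    field_simp
    ring

end Testing

section Bilinear

open Classical

variable {X : Type*} [MeasurableSpace X]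

/-- Hölder's inequality for finite sums with exponents whose sum is at least one. -/
theorem sum_rpow_mul_rpow_le_of_one_le {ι : Type*} (T : Finset ι) (x y : ι → ℝ≥0∞) {a b : ℝ}
    (hb : 0 ≤ b) (hb1 : b < 1) (hab : 1 ≤ a + b) :
    ∑ i ∈ T, x i ^ a * y i ^ b ≤ (∑ i ∈ T, x i) ^ a * (∑ i ∈ T, y i) ^ b := by
  have h1 : 0 < 1 - b := sub_pos.2 hb1
  have h2 : a / (1 - b) * (1 - b) = a := div_mul_cancel₀ _ h1.ne'
  calc ∑ i ∈ T, x i ^ a * y i ^ b = ∑ i ∈ T, (x i ^ (a / (1 - b))) ^ (1 - b) * y i ^ b := by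
        simp_rw [← ENNReal.rpow_mul, h2]
    _ ≤ (∑ i ∈ T, x i ^ (a / (1 - b))) ^ (1 - b) * (∑ i ∈ T, y i) ^ b :=
        sum_rpow_mul_rpow_le T _ y h1.le hb (by ring)
    _ ≤ ((∑ i ∈ T, x i) ^ (a / (1 - b))) ^ (1 - b) * (∑ i ∈ T, y i) ^ b := by
        gcongr
        exact sum_rpow_le_rpow_sum T x ((one_le_div h1).2 (by linarith))
    _ = _ := by rw [← ENNReal.rpow_mul, h2]

/-- One half of the two-weight bilinear estimate: the part of the form in which the principal sets
of the second function lie below those of the first. -/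
theorem sum_principal_le {S : Finset (Set X)} (hS : IsLaminar S) {σ ω : Measure X}
    (h0 : ∀ Q ∈ S, ω Q ≠ 0) (ht : ∀ Q ∈ S, ω Q ≠ ⊤) {m m' : Set X → ℝ≥0∞} {π ρ : Set X → Set X}
    {k j : Set X → ℤ} (hπ : IsPrincipal S m π k) (hρ : IsPrincipal S m' ρ j)
    (c φ γ : Set X → ℝ≥0∞) {s s' t : ℝ} (hs : s.HolderConjugate s') (hts : 1 ≤ 1 / t + 1 / s')
    (ht0 : 0 < t) (𝒯 : ℝ≥0∞)
    (htest : ∀ F ∈ S, (∫⁻ x, (∑ Q ∈ S with Q ⊆ F, Q.indicator (fun _ => c Q / ω Q) x) ^ s ∂ω) ^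
      (1 / s) ≤ 𝒯 * σ F ^ (1 / t)) :
    ∑ Q ∈ S with ρ Q ⊆ π Q, c Q * (φ (π Q) * γ (ρ Q)) ≤
      𝒯 * ((∑ F ∈ S.image π, φ F ^ t * σ F) ^ (1 / t) *
        (∑ G ∈ S.image ρ, γ G ^ s' * ω G) ^ (1 / s')) := by
  have hs' : 0 < s' := hs.symm.pos
  set P : Set X → X → ℝ≥0∞ :=
    fun F x => ∑ G ∈ S.image ρ with π G = F, G.indicator (fun _ => γ G ^ s') x with hP
  have hIm : ∀ F, ∀ G ∈ (S.image ρ).filter (fun G => π G = F), MeasurableSet G := fun F G hG =>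
    hS.meas G (hρ.image_subset (Finset.mem_filter.1 hG).1)
  have hPm : ∀ F, Measurable (P F) := fun F =>
    Finset.measurable_fun_sum _ fun G hG => measurable_const.indicator (hIm F G hG)
  have hPint : ∀ F, ∫⁻ x, P F x ∂ω = ∑ G ∈ S.image ρ with π G = F, γ G ^ s' * ω G := by
    intro F
    rw [hP]
    simp only
    rw [lintegral_finsetSum _ fun G hG => measurable_const.indicator (hIm F G hG)]
    exact Finset.sum_congr rfl fun G hG => lintegral_indicator_const (hIm F G hG) _
  have hfib : ∀ F ∈ S.image π,
      ∑ Q ∈ S with ρ Q ⊆ π Q ∧ π Q = F, c Q * (φ (π Q) * γ (ρ Q)) ≤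
        𝒯 * ((φ F ^ t * σ F) ^ (1 / t) *
          (∑ G ∈ S.image ρ with π G = F, γ G ^ s' * ω G) ^ (1 / s')) := by
    intro F hF
    have hFS := hπ.image_subset hF
    set U : X → ℝ≥0∞ := fun x => ∑ Q ∈ S with Q ⊆ F, Q.indicator (fun _ => c Q / ω Q) x with hU
    have hUm : Measurable U :=
      (hS.mono (Finset.filter_subset _ _)).measurable_sum_indicator _
    calc ∑ Q ∈ S with ρ Q ⊆ π Q ∧ π Q = F, c Q * (φ (π Q) * γ (ρ Q))
        ≤ ∑ Q ∈ S with ρ Q ⊆ π Q ∧ π Q = F,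
            φ F * ∫⁻ x, Q.indicator (fun _ => c Q / ω Q) x * P F x ^ (1 / s') ∂ω := by
          refine Finset.sum_le_sum fun Q hQ => ?_
          rw [Finset.mem_filter] at hQ
          obtain ⟨hQ, hρπ, rfl⟩ := hQ
          rw [mul_left_comm]
          gcongr
          calc c Q * γ (ρ Q) = ∫⁻ x, Q.indicator (fun _ => c Q / ω Q * γ (ρ Q)) x ∂ω := by
                rw [lintegral_indicator_const (hS.meas Q hQ), mul_right_comm,
                  ENNReal.div_mul_cancel (h0 Q hQ) (ht Q hQ)]
            _ ≤ _ := by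
                refine lintegral_mono fun x => ?_
                by_cases hx : x ∈ Q
                · simp only [Set.indicator_of_mem hx]
                  gcongr
                  rw [one_div, ENNReal.le_rpow_inv_iff hs', hP]
                  refine le_trans ?_ (Finset.single_le_sum
                    (f := fun G => G.indicator (fun _ => γ G ^ s') x) (fun _ _ => zero_le)
                    (Finset.mem_filter.2 ⟨Finset.mem_image_of_mem ρ hQ,
                      hπ.between hQ (hρ.mem Q hQ) (hρ.subset Q hQ) hρπ⟩))
                  rw [Set.indicator_of_mem (hρ.subset Q hQ hx)]
                · simp [hx]
      _ = φ F * ∫⁻ x, ∑ Q ∈ S with ρ Q ⊆ π Q ∧ π Q = F,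
            Q.indicator (fun _ => c Q / ω Q) x * P F x ^ (1 / s') ∂ω := by
          rw [← Finset.mul_sum, lintegral_finsetSum]
          intro Q hQ
          exact (measurable_const.indicator (hS.meas Q (Finset.mem_filter.1 hQ).1)).mul
            ((hPm F).pow_const _)
      _ ≤ φ F * ∫⁻ x, (U * fun x => P F x ^ (1 / s')) x ∂ω := by
          gcongr with x
          rw [← Finset.sum_mul, Pi.mul_apply]
          gcongr
          refine Finset.sum_le_sum_of_subset fun Q hQ => ?_
          rw [Finset.mem_filter] at hQ ⊢
          exact ⟨hQ.1, hQ.2.2 ▸ hπ.subset Q hQ.1⟩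
      _ ≤ φ F * ((∫⁻ x, U x ^ s ∂ω) ^ (1 / s) *
            (∫⁻ x, (P F x ^ (1 / s')) ^ s' ∂ω) ^ (1 / s')) := by
          gcongr
          exact ENNReal.lintegral_mul_le_Lp_mul_Lq ω hs hUm.aemeasurable
            ((hPm F).pow_const _).aemeasurable
      _ ≤ φ F * (𝒯 * σ F ^ (1 / t) *
            (∑ G ∈ S.image ρ with π G = F, γ G ^ s' * ω G) ^ (1 / s')) := by
          simp_rw [← ENNReal.rpow_mul, one_div_mul_cancel hs'.ne', ENNReal.rpow_one, hPint]
          refine mul_le_mul_right (mul_le_mul_left (htest F hFS) _) _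
      _ = _ := by
          rw [ENNReal.mul_rpow_of_nonneg _ _ (by positivity : 0 ≤ 1 / t), ← ENNReal.rpow_mul,
            mul_one_div_cancel ht0.ne', ENNReal.rpow_one]
          ring
  calc ∑ Q ∈ S with ρ Q ⊆ π Q, c Q * (φ (π Q) * γ (ρ Q))
      = ∑ F ∈ S.image π, ∑ Q ∈ S with ρ Q ⊆ π Q ∧ π Q = F, c Q * (φ (π Q) * γ (ρ Q)) := by
        rw [← Finset.sum_fiberwise_of_maps_to (t := S.image π) (g := π)
          (fun Q hQ => Finset.mem_image_of_mem π (Finset.mem_filter.1 hQ).1)]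
        simp_rw [Finset.filter_filter]
    _ ≤ ∑ F ∈ S.image π, 𝒯 * ((φ F ^ t * σ F) ^ (1 / t) *
          (∑ G ∈ S.image ρ with π G = F, γ G ^ s' * ω G) ^ (1 / s')) := Finset.sum_le_sum hfib
    _ ≤ 𝒯 * ((∑ F ∈ S.image π, φ F ^ t * σ F) ^ (1 / t) *
          (∑ F ∈ S.image π, ∑ G ∈ S.image ρ with π G = F, γ G ^ s' * ω G) ^ (1 / s')) := by
        rw [← Finset.mul_sum]
        refine mul_le_mul_right (sum_rpow_mul_rpow_le_of_one_le _ _ _ (by positivity) ?_ hts) _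
        rw [div_lt_one hs']
        exact hs.symm.lt
    _ = _ := by
        rw [Finset.sum_fiberwise_of_maps_to (t := S.image π) (g := π)
          (fun G hG => Finset.mem_image_of_mem π (hρ.image_subset hG))]

end Bilinear

section Main

open Classical

variable {X : Type*} [MeasurableSpace X]

/-- Minkowski's inequality for finite sums. -/
theorem lintegral_rpow_sum_rpow_le {ι : Type*} (T : Finset ι) {μ : Measure X} {s : ℝ} (hs : 1 ≤ s)
    (g : ι → X → ℝ≥0∞) (hg : ∀ i ∈ T, Measurable (g i)) :
    (∫⁻ x, (∑ i ∈ T, g i x) ^ s ∂μ) ^ (1 / s) ≤ ∑ i ∈ T, (∫⁻ x, g i x ^ s ∂μ) ^ (1 / s) := by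
  have hs0 : 0 < s := by linarith
  induction T using Finset.induction_on with
  | empty => simp [hs0]
  | insert a T ha ih =>
    simp_rw [Finset.sum_insert ha]
    have hT : ∀ i ∈ T, Measurable (g i) := fun i hi => hg i (Finset.mem_insert_of_mem hi)
    refine (ENNReal.lintegral_Lp_add_le (f := g a) (g := fun x => ∑ i ∈ T, g i x)
      (hg a (Finset.mem_insert_self a T)).aemeasurable
      (Finset.measurable_fun_sum _ hT).aemeasurable hs).trans ?_
    gcongr
    exact ih hT

/-- A principal decomposition of a laminar family with respect to averages of `f`. -/
theorem IsLaminar.exists_isPrincipal_average {p : ℝ} (hp : 1 < p) :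
    ∃ C : ℝ≥0∞, C ≠ ⊤ ∧ ∀ (S : Finset (Set X)), IsLaminar S → ∀ σ : Measure X,
      (∀ Q ∈ S, σ Q ≠ 0) → (∀ Q ∈ S, σ Q ≠ ⊤) → ∀ f : X → ℝ≥0∞, Measurable f →
      (∀ Q ∈ S, ∫⁻ x in Q, f x ∂σ ≠ 0) → ∫⁻ x, f x ^ p ∂σ ≠ ⊤ →
      ∃ π l, IsPrincipal S (fun Q => (∫⁻ x in Q, f x ∂σ) / σ Q) π l ∧
        (∑ F ∈ S.image π, ((2 : ℝ≥0∞) ^ l F) ^ p * σ F ≤ C * ∫⁻ x, f x ^ p ∂σ) ∧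
        (∀ Q ∈ S, ∫⁻ x in Q, f x ∂σ ≤ 2 * 2 ^ l (π Q) * σ Q) ∧
        ∀ Q ∈ S, ∫⁻ x in Q, f x ∂σ ≠ ⊤ := by
  obtain ⟨C, hC, H⟩ := exists_sum_principal_le (X := X) hp
  refine ⟨C, hC, fun S hS σ h0 ht f hf hf0 hft => ?_⟩
  have hp0 : 0 < p := by linarith
  have hfin : ∀ Q ∈ S, ∫⁻ x in Q, f x ∂σ ≠ ⊤ := by
    intro Q hQ
    have := setLIntegral_rpow_le (μ := σ) (hf.pow_const p) Q (τ := 1 / p) (by positivity)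
      ((div_le_one hp0).2 hp.le)
    simp_rw [← ENNReal.rpow_mul, mul_one_div_cancel hp0.ne', ENNReal.rpow_one] at this
    refine ne_top_of_le_ne_top (ENNReal.mul_ne_top ?_ ?_) this
    · refine ENNReal.rpow_ne_top_of_nonneg (by positivity) ?_
      exact ne_top_of_le_ne_top hft (setLIntegral_le_lintegral _ _)
    · refine ENNReal.rpow_ne_top_of_nonneg ?_ (ht Q hQ)
      rw [sub_nonneg, div_le_one hp0]
      exact hp.le
  obtain ⟨π, l, hπ⟩ := hS.exists_isPrincipal (m := fun Q => (∫⁻ x in Q, f x ∂σ) / σ Q)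
    (fun Q hQ => nonempty_of_measure_ne_zero (h0 Q hQ))
    (fun Q hQ => (ENNReal.div_pos (hf0 Q hQ) (ht Q hQ)).ne')
    (fun Q hQ => (ENNReal.div_lt_top (hfin Q hQ) (h0 Q hQ)).ne)
  refine ⟨π, l, hπ, H S hS σ h0 ht f hf π l hπ, fun Q hQ => ?_, hfin⟩
  have := hπ.le Q hQ
  rwa [← hπ.level Q hQ, ENNReal.div_le_iff (h0 Q hQ) (ht Q hQ)] at this

/-- A principal decomposition of a family with respect to averages of `f`, together with the
resulting bounds for the coefficients of the sparse operator. -/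
theorem exists_principal {p q α n : ℝ} (hp : 1 < p) :
    ∃ C : ℝ≥0∞, C ≠ ⊤ ∧ ∀ (S : Finset (Set X)) (k : Set X → ℤ) (v σ ω : Measure X)
      (Λ Λσ Λω K : ℝ≥0∞), IsTwoWeight p q α n S k v σ ω Λ Λσ Λω K → ∀ f : X → ℝ≥0∞, Measurable f →
      (∀ Q ∈ S, ∫⁻ x in Q, f x ∂σ ≠ 0) → ∫⁻ x, f x ^ p ∂σ ≠ ⊤ →
      ∃ π l, IsPrincipal S (fun Q => (∫⁻ x in Q, f x ∂σ) / σ Q) π l ∧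
        (∑ F ∈ S.image π, ((2 : ℝ≥0∞) ^ l F) ^ p * σ F ≤ C * ∫⁻ x, f x ^ p ∂σ) ∧
        (∀ Q ∈ S, v Q ^ (-α) * ∫⁻ x in Q, f x ∂σ ≤ 2 * (v Q ^ (-α) * σ Q) * 2 ^ l (π Q)) ∧
        ∀ Q ∈ S, ∫⁻ x in Q, f x ∂σ ≠ ⊤ := by
  obtain ⟨C, hC, H⟩ := IsLaminar.exists_isPrincipal_average (X := X) hp
  refine ⟨C, hC, fun S k v σ ω Λ Λσ Λω K h f hf hf0 hft => ?_⟩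
  obtain ⟨π, l, hπ, hsum, hle, hfin⟩ :=
    H S h.scaled.laminar σ h.left.ne_zero h.left.ne_top f hf hf0 hft
  refine ⟨π, l, hπ, hsum, fun Q hQ => ?_, hfin⟩
  calc _ ≤ v Q ^ (-α) * (2 * 2 ^ l (π Q) * σ Q) := by
        gcongr
        exact hle Q hQ
    _ = _ := by ring

/-- The two-weight estimate for `q ≤ r`. -/
theorem exists_bound_of_le {p q r α n : ℝ} (hp : 1 < p) (hpq : p ≤ q) (hqr : q ≤ r) :
    ∃ C : ℝ≥0∞, C ≠ ⊤ ∧ ∀ (S : Finset (Set X)) (k : Set X → ℤ) (v σ ω : Measure X)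
      (Λ Λσ Λω K : ℝ≥0∞), IsTwoWeight p q α n S k v σ ω Λ Λσ Λω K → ∀ f : X → ℝ≥0∞, Measurable f →
      (∀ Q ∈ S, ∫⁻ x in Q, f x ∂σ ≠ 0) → ∫⁻ x, f x ^ p ∂σ ≠ ⊤ →
      (∫⁻ x, (∑ Q ∈ S, Q.indicator (fun _ => (v Q ^ (-α) * ∫⁻ x in Q, f x ∂σ) ^ r) x) ^ (q / r) ∂ω)
        ^ (1 / q) ≤ C * K * Λσ ^ (1 / q) * (∫⁻ x, f x ^ p ∂σ) ^ (1 / p) := by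
  obtain ⟨C, hC, H⟩ := exists_principal (X := X) (q := q) (α := α) (n := n) hp
  have hp0 : 0 < p := by linarith
  have hq0 : 0 < q := by linarith
  have hr0 : 0 < r := by linarith
  refine ⟨2 * C ^ (1 / p), by finiteness, fun S k v σ ω Λ Λσ Λω K h f hf hf0 hft => ?_⟩
  obtain ⟨π, l, hπ, hsum, hle, -⟩ := H S k v σ ω Λ Λσ Λω K h f hf hf0 hft
  have hmain : ∫⁻ x, (∑ Q ∈ S, Q.indicator (fun _ => (v Q ^ (-α) * ∫⁻ x in Q, f x ∂σ) ^ r) x)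
      ^ (q / r) ∂ω ≤ (2 * K) ^ q * Λσ * (C * ∫⁻ x, f x ^ p ∂σ) ^ (q / p) := by
    calc _ ≤ ∫⁻ x, ∑ Q ∈ S, Q.indicator (fun _ => (v Q ^ (-α) * ∫⁻ x in Q, f x ∂σ) ^ q) x ∂ω := by
          refine lintegral_mono fun x => ?_
          simp only
          rw [sum_indicator_eq, sum_indicator_eq]
          refine (rpow_sum_le_sum_rpow _ _ (by positivity) ((div_le_one hr0).2 hqr)).trans ?_
          simp_rw [← ENNReal.rpow_mul, mul_div_cancel₀ _ hr0.ne', le_refl]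
      _ = ∑ Q ∈ S, (v Q ^ (-α) * ∫⁻ x in Q, f x ∂σ) ^ q * ω Q := by
          rw [lintegral_finsetSum _ fun Q hQ =>
            measurable_const.indicator (h.scaled.laminar.meas Q hQ)]
          exact Finset.sum_congr rfl fun Q hQ =>
            lintegral_indicator_const (h.scaled.laminar.meas Q hQ) _
      _ ≤ ∑ Q ∈ S, (2 * K) ^ q * (((2 : ℝ≥0∞) ^ l (π Q)) ^ q * σ Q ^ (q / p)) := by
          refine Finset.sum_le_sum fun Q hQ => ?_
          calc _ ≤ (2 * (v Q ^ (-α) * σ Q) * 2 ^ l (π Q)) ^ q * ω Q := by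
                exact mul_le_mul_left (ENNReal.rpow_le_rpow (hle Q hQ) hq0.le) _
            _ ≤ _ := by
                obtain ⟨x, y, z, w, hx, hy, hz, rfl, hlog⟩ := h.exists_log hQ
                simp only [hx, hy, hz, two_zpow_eq_eexp]
                simp only [two_eq_eexp, eexp_rpow, eexp_mul, eexp_le]
                have := mul_le_mul_of_nonneg_left hlog hq0.le
                refine sub_nonneg.1 (le_of_le_of_eq (sub_nonneg.2 this) ?_)
                field_simp
                ring
      _ = (2 * K) ^ q * ∑ F ∈ S.image π, ((2 : ℝ≥0∞) ^ l F) ^ q *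
            ∑ Q ∈ S with π Q = F, σ Q ^ (q / p) := by
          rw [← Finset.mul_sum]
          congr 1
          rw [← Finset.sum_fiberwise_of_maps_to (t := S.image π) (g := π)
            (fun Q hQ => Finset.mem_image_of_mem π hQ)]
          refine Finset.sum_congr rfl fun F _ => ?_
          rw [Finset.mul_sum]
          refine Finset.sum_congr rfl fun Q hQ => ?_
          rw [(Finset.mem_filter.1 hQ).2]
      _ ≤ (2 * K) ^ q * ∑ F ∈ S.image π, Λσ * (((2 : ℝ≥0∞) ^ l F) ^ p * σ F) ^ (q / p) := by
          refine mul_le_mul_right (Finset.sum_le_sum fun F hF => ?_) _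
          have hFS := hπ.image_subset hF
          calc _ ≤ ((2 : ℝ≥0∞) ^ l F) ^ q * (Λσ * σ F ^ (q / p)) := by
                gcongr
                refine sum_rpow_le_of_sum_le ((one_le_div hp0).2 hpq) (fun Q hQ => ?_) ?_
                · rw [Finset.mem_filter] at hQ
                  exact measure_mono (hQ.2 ▸ hπ.subset Q hQ.1)
                · refine (Finset.sum_le_sum_of_subset fun Q hQ => ?_).trans (h.left.sum_le F hFS)
                  rw [Finset.mem_filter] at hQ ⊢
                  exact ⟨hQ.1, hQ.2 ▸ hπ.subset Q hQ.1⟩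
            _ = _ := by
                rw [ENNReal.mul_rpow_of_nonneg _ _ (by positivity : 0 ≤ q / p), ← ENNReal.rpow_mul,
                  mul_div_cancel₀ _ hp0.ne']
                ring
      _ ≤ (2 * K) ^ q * (Λσ * (C * ∫⁻ x, f x ^ p ∂σ) ^ (q / p)) := by
          rw [← Finset.mul_sum]
          gcongr
          exact (sum_rpow_le_rpow_sum _ _ ((one_le_div hp0).2 hpq)).trans (by gcongr)
      _ = _ := by ring
  calc _ ≤ ((2 * K) ^ q * Λσ * (C * ∫⁻ x, f x ^ p ∂σ) ^ (q / p)) ^ (1 / q) := by gcongr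
    _ = _ := by
        have hq1 : 0 ≤ 1 / q := by positivity
        have hp1 : 0 ≤ 1 / p := by positivity
        rw [ENNReal.mul_rpow_of_nonneg _ _ hq1, ENNReal.mul_rpow_of_nonneg _ _ hq1,
          ← ENNReal.rpow_mul, ← ENNReal.rpow_mul, mul_one_div_cancel hq0.ne', ENNReal.rpow_one,
          show q / p * (1 / q) = 1 / p by field_simp, ENNReal.mul_rpow_of_nonneg _ _ hp1]
        ring

/-- The two-weight estimate for `p ≤ r < q`. -/
theorem exists_bound_of_le_of_lt {p q r α n θ : ℝ} {Λ : ℝ≥0∞} (hn : 0 < n) (hα : 0 < α)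
    (hΛ : Λ ≠ ⊤) (hp : 1 < p) (hpr : p ≤ r) (hrq : r < q) (hθ : IsExponent p q r α θ) :
    ∃ C : ℝ≥0∞, C ≠ ⊤ ∧ ∀ (S : Finset (Set X)) (k : Set X → ℤ) (v σ ω : Measure X)
      (Λσ Λω K : ℝ≥0∞), IsTwoWeight p q α n S k v σ ω Λ Λσ Λω K → ∀ f : X → ℝ≥0∞, Measurable f →
      (∀ Q ∈ S, ∫⁻ x in Q, f x ∂σ ≠ 0) → ∫⁻ x, f x ^ p ∂σ ≠ ⊤ →
      (∫⁻ x, (∑ Q ∈ S, Q.indicator (fun _ => (v Q ^ (-α) * ∫⁻ x in Q, f x ∂σ) ^ r) x) ^ (q / r) ∂ω)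
        ^ (1 / q) ≤ C * K * Λσ ^ (1 / q) * (∫⁻ x, f x ^ p ∂σ) ^ (1 / p) := by
  have hp0 : 0 < p := by linarith
  have hr0 : 0 < r := by linarith
  have hq0 : 0 < q := by linarith
  obtain ⟨C, hC, H⟩ := exists_principal (X := X) (q := q) (α := α) (n := n) hp
  obtain ⟨B, hB, Htest⟩ := exists_testing (X := X) hn hα hΛ hp (hpr.trans hrq.le) hr0 hrq hθ
  refine ⟨2 * B ^ (1 / q) * C ^ (1 / p), by finiteness,
    fun S k v σ ω Λσ Λω K h f hf hf0 hft => ?_⟩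
  obtain ⟨π, l, hπ, hsum, hle, -⟩ := H S k v σ ω Λ Λσ Λω K h f hf hf0 hft
  have hs : 1 < q / r := (one_lt_div hr0).2 hrq
  set U : Set X → X → ℝ≥0∞ :=
    fun F x => ∑ Q ∈ S with Q ⊆ F, Q.indicator (fun _ => (v Q ^ (-α) * σ Q) ^ r) x with hU
  have hUm : ∀ F, Measurable (U F) := fun F =>
    (h.scaled.laminar.mono (Finset.filter_subset _ _)).measurable_sum_indicator _
  have hmain : (∫⁻ x, (∑ Q ∈ S, Q.indicator (fun _ => (v Q ^ (-α) * ∫⁻ x in Q, f x ∂σ) ^ r) x)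
      ^ (q / r) ∂ω) ^ (1 / (q / r)) ≤
      2 ^ r * (B * K ^ q * Λσ) ^ (r / q) * (C * ∫⁻ x, f x ^ p ∂σ) ^ (r / p) := by
    calc _ ≤ (∫⁻ x, (∑ F ∈ S.image π, (2 * (2 : ℝ≥0∞) ^ l F) ^ r * U F x) ^ (q / r) ∂ω)
          ^ (1 / (q / r)) := by
          gcongr with x
          rw [← Finset.sum_fiberwise_of_maps_to (t := S.image π) (g := π)
            (fun Q hQ => Finset.mem_image_of_mem π hQ)]
          refine Finset.sum_le_sum fun F hF => ?_
          rw [hU, Finset.mul_sum]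
          refine (Finset.sum_le_sum fun Q hQ => ?_).trans
            (Finset.sum_le_sum_of_subset (s := S.filter fun Q => π Q = F) fun Q hQ => ?_)
          · rw [Finset.mem_filter] at hQ
            by_cases hx : x ∈ Q
            · simp only [Set.indicator_of_mem hx]
              rw [← ENNReal.mul_rpow_of_nonneg _ _ hr0.le]
              refine ENNReal.rpow_le_rpow ((hle Q hQ.1).trans (le_of_eq ?_)) hr0.le
              rw [hQ.2]
              ring
            · simp [hx]
          · rw [Finset.mem_filter] at hQ ⊢
            exact ⟨hQ.1, hQ.2 ▸ hπ.subset Q hQ.1⟩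
      _ ≤ ∑ F ∈ S.image π, (∫⁻ x, ((2 * (2 : ℝ≥0∞) ^ l F) ^ r * U F x) ^ (q / r) ∂ω)
          ^ (1 / (q / r)) :=
          lintegral_rpow_sum_rpow_le _ hs.le _ fun F _ => (hUm F).const_mul _
      _ ≤ ∑ F ∈ S.image π, 2 ^ r * (B * K ^ q * Λσ) ^ (r / q) *
            (((2 : ℝ≥0∞) ^ l F) ^ p * σ F) ^ (r / p) := by
          refine Finset.sum_le_sum fun F hF => ?_
          have hs0 : 0 ≤ q / r := by positivity
          have hs1 : 0 ≤ 1 / (q / r) := by positivity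
          calc _ = (2 * (2 : ℝ≥0∞) ^ l F) ^ r * (∫⁻ x, U F x ^ (q / r) ∂ω) ^ (1 / (q / r)) := by
                simp_rw [ENNReal.mul_rpow_of_nonneg _ _ hs0]
                rw [lintegral_const_mul _ ((hUm F).pow_const _),
                  ENNReal.mul_rpow_of_nonneg _ _ hs1, ← ENNReal.rpow_mul ((2 * 2 ^ l F) ^ r),
                  mul_one_div_cancel (by positivity), ENNReal.rpow_one]
            _ ≤ (2 * (2 : ℝ≥0∞) ^ l F) ^ r *
                  (B * K ^ q * Λσ * σ F ^ (q / p)) ^ (1 / (q / r)) := by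
                gcongr
                exact Htest S k v σ ω Λσ Λω K h F (hπ.image_subset hF)
            _ = _ := by
                rw [ENNReal.mul_rpow_of_nonneg _ _ hs1, ENNReal.mul_rpow_of_nonneg _ _ hr0.le,
                  ← ENNReal.rpow_mul (σ F), one_div_div,
                  show q / p * (r / q) = r / p by field_simp,
                  ENNReal.mul_rpow_of_nonneg _ _ (by positivity : 0 ≤ r / p), ← ENNReal.rpow_mul _ p,
                  mul_div_cancel₀ _ hp0.ne']
                ring
      _ ≤ _ := by
          rw [← Finset.mul_sum]
          gcongr
          exact (sum_rpow_le_rpow_sum _ _ ((one_le_div hp0).2 hpr)).trans (by gcongr)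
  calc _ = ((∫⁻ x, (∑ Q ∈ S, Q.indicator (fun _ => (v Q ^ (-α) * ∫⁻ x in Q, f x ∂σ) ^ r) x)
      ^ (q / r) ∂ω) ^ (1 / (q / r))) ^ (1 / r) := by
        rw [← ENNReal.rpow_mul, show 1 / (q / r) * (1 / r) = 1 / q by field_simp]
    _ ≤ (2 ^ r * (B * K ^ q * Λσ) ^ (r / q) * (C * ∫⁻ x, f x ^ p ∂σ) ^ (r / p)) ^ (1 / r) := by
        gcongr
    _ = _ := by
        have hr1 : 0 ≤ 1 / r := by positivity
        have hq1 : 0 ≤ 1 / q := by positivity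
        have hp1 : 0 ≤ 1 / p := by positivity
        rw [ENNReal.mul_rpow_of_nonneg _ _ hr1, ENNReal.mul_rpow_of_nonneg _ _ hr1,
          ← ENNReal.rpow_mul, ← ENNReal.rpow_mul, ← ENNReal.rpow_mul, mul_one_div_cancel hr0.ne',
          ENNReal.rpow_one, show r / p * (1 / r) = 1 / p by field_simp,
          show r / q * (1 / r) = 1 / q by field_simp, ENNReal.mul_rpow_of_nonneg _ _ hp1,
          ENNReal.mul_rpow_of_nonneg _ _ hq1, ENNReal.mul_rpow_of_nonneg _ _ hq1,
          ← ENNReal.rpow_mul K, mul_one_div_cancel hq0.ne', ENNReal.rpow_one]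
        ring

theorem add_rpow_le_mul_add_rpow (x y : ℝ≥0∞) {κ : ℝ} (hκ : 0 ≤ κ) :
    (x + y) ^ κ ≤ 2 ^ κ * (x ^ κ + y ^ κ) := by
  rcases le_total x y with h | h
  · calc (x + y) ^ κ ≤ (2 * y) ^ κ := by
          rw [two_mul]
          gcongr
      _ = 2 ^ κ * y ^ κ := ENNReal.mul_rpow_of_nonneg _ _ hκ
      _ ≤ _ := by
          gcongr
          exact le_add_self
  · calc (x + y) ^ κ ≤ (2 * x) ^ κ := by
          rw [two_mul]
          gcongr
      _ = 2 ^ κ * x ^ κ := ENNReal.mul_rpow_of_nonneg _ _ hκ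
      _ ≤ _ := by
          gcongr
          exact le_self_add

theorem IsLaminar.lintegral_rpow_sum_ne_top {S : Finset (Set X)} (hS : IsLaminar S)
    {μ : Measure X} (ht : ∀ Q ∈ S, μ Q ≠ ⊤) (a : Set X → ℝ≥0∞) (ha : ∀ Q ∈ S, a Q ≠ ⊤) {s : ℝ}
    (hs : 1 ≤ s) : ∫⁻ x, (∑ Q ∈ S, Q.indicator (fun _ => a Q) x) ^ s ∂μ ≠ ⊤ := by
  have hs0 : 0 < s := by linarith
  have := lintegral_rpow_sum_rpow_le S (μ := μ) hs (fun Q x => Q.indicator (fun _ => a Q) x)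
    fun Q hQ => measurable_const.indicator (hS.meas Q hQ)
  intro htop
  rw [htop, ENNReal.top_rpow_of_pos (by positivity), top_le_iff, ENNReal.sum_eq_top] at this
  obtain ⟨Q, hQ, h⟩ := this
  revert h
  refine ENNReal.rpow_ne_top_of_nonneg (by positivity) ?_
  have : ∀ x, Q.indicator (fun _ => a Q) x ^ s = Q.indicator (fun _ => a Q ^ s) x := by
    intro x
    by_cases hx : x ∈ Q <;> simp [hx, hs0]
  simp_rw [this]
  rw [lintegral_indicator_const (hS.meas Q hQ)]
  exact ENNReal.mul_ne_top (ENNReal.rpow_ne_top_of_nonneg hs0.le (ha Q hQ)) (ht Q hQ)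

/-- Duality for a positive combination of indicators: the `s`-th power integral is linearised by
the function `g`, the `(s - 1)`-st power of the combination. -/
theorem IsLaminar.lintegral_rpow_sum_eq {S : Finset (Set X)} (hS : IsLaminar S) {μ : Measure X}
    (a : Set X → ℝ≥0∞) {s : ℝ} (hs : 1 ≤ s) :
    ∫⁻ x, (∑ Q ∈ S, Q.indicator (fun _ => a Q) x) ^ s ∂μ =
      ∑ Q ∈ S, a Q *
        ∫⁻ x in Q, (∑ R ∈ S, R.indicator (fun _ => a R) x) ^ (s - 1) ∂μ := by
  have hu := hS.measurable_sum_indicator a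
  simp_rw [← mul_rpow_sub_one _ hs, Finset.sum_mul]
  rw [lintegral_finsetSum]
  swap
  · exact fun Q hQ => (measurable_const.indicator (hS.meas Q hQ)).mul (hu.pow_const _)
  refine Finset.sum_congr rfl fun Q hQ => ?_
  rw [← lintegral_const_mul _ (hu.pow_const _), ← lintegral_indicator (hS.meas Q hQ)]
  refine lintegral_congr fun x => ?_
  by_cases hx : x ∈ Q <;> simp [hx]

/-- The bilinear two-weight estimate for `r < p`, linearised by duality. -/
theorem exists_sum_bilinear_le {p q r α n θ : ℝ} {Λ : ℝ≥0∞} (hn : 0 < n) (hα : 0 < α)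
    (hΛ : Λ ≠ ⊤) (hp : 1 < p) (hpq : p ≤ q) (hr : 0 < r) (hrp : r < p)
    (hθ : IsExponent p q r α θ) :
    ∃ C : ℝ≥0∞, C ≠ ⊤ ∧ ∀ (S : Finset (Set X)) (k : Set X → ℤ) (v σ ω : Measure X)
      (Λσ Λω K : ℝ≥0∞), IsTwoWeight p q α n S k v σ ω Λ Λσ Λω K →
      ∀ (m m' : Set X → ℝ≥0∞) (π ρ : Set X → Set X) (l j : Set X → ℤ), IsPrincipal S m π l →
      IsPrincipal S m' ρ j → ∀ φ γ : Set X → ℝ≥0∞,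
      ∑ Q ∈ S, (v Q ^ (-α) * σ Q) ^ r * ω Q * (φ (π Q) * γ (ρ Q)) ≤
        C * K ^ r * (Λσ ^ (r / q) + Λω ^ (1 - r / p)) *
          ((∑ F ∈ S.image π, φ F ^ (p / r) * σ F) ^ (r / p) *
            (∑ G ∈ S.image ρ, γ G ^ (1 - r / q)⁻¹ * ω G) ^ (1 - r / q)) := by
  have hp0 : 0 < p := by linarith
  have hq0 : 0 < q := by linarith
  have hrq : r < q := hrp.trans_le hpq
  obtain ⟨B, hB, Htest⟩ := exists_testing (X := X) hn hα hΛ hp hpq hr hrq hθ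
  obtain ⟨D, hD, Hdual⟩ := exists_testing_dual (X := X) hn hα hΛ hp hpq hr hrp hθ
  have h1 : 0 < 1 - r / q := by rw [sub_pos, div_lt_one hq0]; exact hrq
  have h2 : 0 < 1 - r / p := by rw [sub_pos, div_lt_one hp0]; exact hrp
  have hpr : p / (p - r) = (1 - r / p)⁻¹ := by
    have : p - r ≠ 0 := by linarith
    have : 1 - r / p = (p - r) / p := by field_simp
    rw [this, inv_div]
  have hts : 1 ≤ r / p + (1 - r / q) := by
    have : r / q ≤ r / p := by gcongr
    linarith
  have hs : (q / r).HolderConjugate (1 - r / q)⁻¹ := by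
    rw [Real.holderConjugate_iff]
    exact ⟨(one_lt_div hr).2 hrq, by rw [inv_inv, inv_div]; ring⟩
  have ht : (p / r).HolderConjugate (p / (p - r)) := by
    rw [Real.holderConjugate_iff, hpr]
    exact ⟨(one_lt_div hr).2 hrp, by rw [inv_inv, inv_div]; ring⟩
  refine ⟨B ^ (r / q) + D ^ (1 - r / p), by finiteness,
    fun S k v σ ω Λσ Λω K h m m' π ρ l j hπ hρ φ γ => ?_⟩
  set c : Set X → ℝ≥0∞ := fun Q => (v Q ^ (-α) * σ Q) ^ r * ω Q with hc
  set Φ := (∑ F ∈ S.image π, φ F ^ (p / r) * σ F) ^ (r / p) with hΦ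
  set Γ := (∑ G ∈ S.image ρ, γ G ^ (1 - r / q)⁻¹ * ω G) ^ (1 - r / q) with hΓ
  have hS := h.scaled.laminar
  have hleft : ∑ Q ∈ S with ρ Q ⊆ π Q, c Q * (φ (π Q) * γ (ρ Q)) ≤
      (B * K ^ q * Λσ) ^ (r / q) * (Φ * Γ) := by
    have := sum_principal_le hS h.right.ne_zero h.right.ne_top (σ := σ) hπ hρ c φ γ hs
      (t := p / r) (by rwa [one_div_div, one_div, inv_inv]) (by positivity)
      ((B * K ^ q * Λσ) ^ (r / q)) ?_
    · rwa [one_div_div, one_div, inv_inv] at this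
    · intro F hF
      have := Htest S k v σ ω Λσ Λω K h F hF
      rw [one_div_div, one_div_div]
      calc _ = (∫⁻ x, (∑ Q ∈ S with Q ⊆ F,
              Q.indicator (fun _ => (v Q ^ (-α) * σ Q) ^ r) x) ^ (q / r) ∂ω) ^ (r / q) := by
            congr 1
            refine lintegral_congr fun x => ?_
            congr 1
            refine Finset.sum_congr rfl fun Q hQ => ?_
            have hQS := (Finset.mem_filter.1 hQ).1
            rw [hc]
            simp only
            rw [ENNReal.mul_div_cancel_right (h.right.ne_zero Q hQS) (h.right.ne_top Q hQS)]
        _ ≤ (B * K ^ q * Λσ * σ F ^ (q / p)) ^ (r / q) :=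
            ENNReal.rpow_le_rpow this (by positivity)
        _ = _ := by
            rw [ENNReal.mul_rpow_of_nonneg _ _ (by positivity), ← ENNReal.rpow_mul,
              show q / p * (r / q) = r / p by field_simp]
  have hright : ∑ Q ∈ S with π Q ⊆ ρ Q, c Q * (φ (π Q) * γ (ρ Q)) ≤
      (D * K ^ (r * (p / (p - r))) * Λω) ^ (1 - r / p) * (Φ * Γ) := by
    have := sum_principal_le hS h.left.ne_zero h.left.ne_top (σ := ω) hρ hπ c γ φ ht.symm
      (t := (1 - r / q)⁻¹) (by rw [one_div_div, one_div, inv_inv]; linarith) (by positivity)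
      ((D * K ^ (r * (p / (p - r))) * Λω) ^ (1 - r / p)) ?_
    · rw [one_div_div, one_div, inv_inv] at this
      rw [mul_comm Φ]
      refine le_trans (le_of_eq ?_) this
      exact Finset.sum_congr rfl fun Q _ => by ring
    · intro F hF
      have := Hdual S k v σ ω Λσ Λω K h F hF
      rw [one_div (1 - r / q)⁻¹, inv_inv, show 1 / (p / (p - r)) = 1 - r / p by
        rw [hpr, one_div, inv_inv]]
      refine (ENNReal.rpow_le_rpow this h2.le).trans (le_of_eq ?_)
      rw [ENNReal.mul_rpow_of_nonneg _ _ h2.le, ← ENNReal.rpow_mul (ω F), hpr,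
        mul_right_comm (1 - r / p)⁻¹, inv_mul_cancel₀ h2.ne', one_mul]
  calc _ ≤ ∑ Q ∈ S with ρ Q ⊆ π Q, c Q * (φ (π Q) * γ (ρ Q)) +
          ∑ Q ∈ S with π Q ⊆ ρ Q, c Q * (φ (π Q) * γ (ρ Q)) := by
        rw [← Finset.sum_filter_add_sum_filter_not S (fun Q => ρ Q ⊆ π Q)]
        refine add_le_add_right (Finset.sum_le_sum_of_subset fun Q hQ => ?_) _
        rw [Finset.mem_filter] at hQ ⊢
        refine ⟨hQ.1, ?_⟩
        obtain ⟨x, hx⟩ := nonempty_of_measure_ne_zero (h.left.ne_zero Q hQ.1)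
        exact (hS.le_or_le (hπ.mem Q hQ.1) (hρ.mem Q hQ.1) (hπ.subset Q hQ.1 hx)
          (hρ.subset Q hQ.1 hx)).resolve_right hQ.2
    _ ≤ ((B * K ^ q * Λσ) ^ (r / q) + (D * K ^ (r * (p / (p - r))) * Λω) ^ (1 - r / p)) *
          (Φ * Γ) := by
        rw [add_mul]
        exact add_le_add hleft hright
    _ ≤ _ := by
        refine mul_le_mul_left ?_ _
        have h3 : 0 ≤ r / q := by positivity
        rw [ENNReal.mul_rpow_of_nonneg _ _ h3, ENNReal.mul_rpow_of_nonneg _ _ h3,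
          ENNReal.mul_rpow_of_nonneg _ _ h2.le, ENNReal.mul_rpow_of_nonneg _ _ h2.le,
          ← ENNReal.rpow_mul, ← ENNReal.rpow_mul, hpr, mul_div_cancel₀ _ hq0.ne', mul_assoc r,
          inv_mul_cancel₀ h2.ne', mul_one]
        calc _ = B ^ (r / q) * K ^ r * Λσ ^ (r / q) + D ^ (1 - r / p) * K ^ r * Λω ^ (1 - r / p) :=
              rfl
          _ ≤ (B ^ (r / q) + D ^ (1 - r / p)) * K ^ r * Λσ ^ (r / q) +
              (B ^ (r / q) + D ^ (1 - r / p)) * K ^ r * Λω ^ (1 - r / p) := by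
              gcongr
              · exact le_self_add
              · exact le_add_self
          _ = _ := by ring

/-- The two-weight estimate for `r < p`. -/
theorem exists_bound_of_lt {p q r α n θ : ℝ} {Λ : ℝ≥0∞} (hn : 0 < n) (hα : 0 < α)
    (hΛ : Λ ≠ ⊤) (hp : 1 < p) (hpq : p ≤ q) (hr : 0 < r) (hrp : r < p)
    (hθ : IsExponent p q r α θ) :
    ∃ C : ℝ≥0∞, C ≠ ⊤ ∧ ∀ (S : Finset (Set X)) (k : Set X → ℤ) (v σ ω : Measure X)
      (Λσ Λω K : ℝ≥0∞), IsTwoWeight p q α n S k v σ ω Λ Λσ Λω K → ∀ f : X → ℝ≥0∞, Measurable f →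
      (∀ Q ∈ S, ∫⁻ x in Q, f x ∂σ ≠ 0) → ∫⁻ x, f x ^ p ∂σ ≠ ⊤ →
      (∫⁻ x, (∑ Q ∈ S, Q.indicator (fun _ => (v Q ^ (-α) * ∫⁻ x in Q, f x ∂σ) ^ r) x) ^ (q / r) ∂ω)
        ^ (1 / q) ≤ C * K * (Λσ ^ (1 / q) + Λω ^ (1 / r - 1 / p)) *
          (∫⁻ x, f x ^ p ∂σ) ^ (1 / p) := by
  have hp0 : 0 < p := by linarith
  have hq0 : 0 < q := by linarith
  have hrq : r < q := hrp.trans_le hpq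
  have hs : 1 < q / r := (one_lt_div hr).2 hrq
  have h1 : 0 < 1 - r / q := by rw [sub_pos, div_lt_one hq0]; exact hrq
  have hs' : 1 < (1 - r / q)⁻¹ := by
    rw [one_lt_inv₀ h1]
    have : 0 < r / q := by positivity
    linarith
  obtain ⟨C, hC, H⟩ := exists_principal (X := X) (q := q) (α := α) (n := n) hp
  obtain ⟨D, hD, HD⟩ := IsLaminar.exists_isPrincipal_average (X := X) hs'
  obtain ⟨B, hB, Hbil⟩ := exists_sum_bilinear_le (X := X) hn hα hΛ hp hpq hr hrp hθ
  refine ⟨(2 ^ r * 2 * B * C ^ (r / p) * D ^ (1 - r / q)) ^ (1 / r) * 2 ^ (1 / r), ?_,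
    fun S k v σ ω Λσ Λω K h f hf hf0 hft => ?_⟩
  · have := hp0.le
    finiteness
  obtain ⟨π, l, hπ, hsum, hle, hfin⟩ := H S k v σ ω Λ Λσ Λω K h f hf hf0 hft
  have hS := h.scaled.laminar
  set a : Set X → ℝ≥0∞ := fun Q => (v Q ^ (-α) * ∫⁻ x in Q, f x ∂σ) ^ r with ha
  have hv0 : ∀ Q ∈ S, v Q ^ (-α) ≠ 0 := fun Q hQ =>
    (ENNReal.rpow_pos (pos_iff_ne_zero.2 (h.vol.ne_zero Q hQ)) (h.vol.ne_top Q hQ)).ne'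
  have hvt : ∀ Q ∈ S, v Q ^ (-α) ≠ ⊤ := fun Q hQ =>
    ENNReal.rpow_ne_top_of_ne_zero (h.vol.ne_zero Q hQ) (h.vol.ne_top Q hQ)
  have hat : ∀ Q ∈ S, a Q ≠ ⊤ := fun Q hQ =>
    ENNReal.rpow_ne_top_of_nonneg hr.le (ENNReal.mul_ne_top (hvt Q hQ) (hfin Q hQ))
  have ha0 : ∀ Q ∈ S, a Q ≠ 0 := fun Q hQ =>
    (ENNReal.rpow_pos (pos_iff_ne_zero.2 (mul_ne_zero (hv0 Q hQ) (hf0 Q hQ)))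
      (ENNReal.mul_ne_top (hvt Q hQ) (hfin Q hQ))).ne'
  set u : X → ℝ≥0∞ := fun x => ∑ Q ∈ S, Q.indicator (fun _ => a Q) x with hu
  have hum : Measurable u := hS.measurable_sum_indicator a
  set N := ∫⁻ x, u x ^ (q / r) ∂ω with hN
  have hNt : N ≠ ⊤ := hS.lintegral_rpow_sum_ne_top h.right.ne_top a hat hs.le
  have hgN : ∫⁻ x, (u x ^ (q / r - 1)) ^ (1 - r / q)⁻¹ ∂ω = N := by
    rw [hN]
    refine lintegral_congr fun x => ?_
    rw [← ENNReal.rpow_mul]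
    congr 1
    have : q - r ≠ 0 := by linarith
    rw [show 1 - r / q = (q - r) / q by field_simp, inv_div]
    field_simp
  have hg0 : ∀ Q ∈ S, ∫⁻ x in Q, u x ^ (q / r - 1) ∂ω ≠ 0 := by
    intro Q hQ
    refine (pos_iff_ne_zero.1 (lt_of_lt_of_le ?_ (setLIntegral_mono (hum.pow_const _)
      (f := fun _ => a Q ^ (q / r - 1)) fun x hx => ?_)))
    · rw [setLIntegral_const]
      exact ENNReal.mul_pos (ENNReal.rpow_pos (pos_iff_ne_zero.2 (ha0 Q hQ)) (hat Q hQ)).ne'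
        (h.right.ne_zero Q hQ)
    · refine ENNReal.rpow_le_rpow ?_ (by linarith)
      refine le_trans ?_ (Finset.single_le_sum (f := fun R => R.indicator (fun _ => a R) x)
        (fun _ _ => zero_le) hQ)
      rw [Set.indicator_of_mem hx]
  obtain ⟨ρ, j, hρ, hsumg, hleg, -⟩ := HD S hS ω h.right.ne_zero h.right.ne_top
    (fun x => u x ^ (q / r - 1)) (hum.pow_const _) hg0 (by rw [hgN]; exact hNt)
  rw [hgN] at hsumg
  set I := ∫⁻ x, f x ^ p ∂σ with hI
  set Z := Λσ ^ (r / q) + Λω ^ (1 - r / p) with hZ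
  have hmain : N ≤ 2 ^ r * 2 * B * C ^ (r / p) * D ^ (1 - r / q) * (K ^ r * Z * I ^ (r / p)) *
      N ^ (1 - r / q) := by
    calc N = ∑ Q ∈ S, a Q * ∫⁻ x in Q, u x ^ (q / r - 1) ∂ω := hS.lintegral_rpow_sum_eq a hs.le
      _ ≤ ∑ Q ∈ S, (2 * (v Q ^ (-α) * σ Q) * 2 ^ l (π Q)) ^ r * (2 * 2 ^ j (ρ Q) * ω Q) :=
          Finset.sum_le_sum fun Q hQ =>
            mul_le_mul' (ENNReal.rpow_le_rpow (hle Q hQ) hr.le) (hleg Q hQ)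
      _ = 2 ^ r * 2 * ∑ Q ∈ S, (v Q ^ (-α) * σ Q) ^ r * ω Q *
            ((fun F => ((2 : ℝ≥0∞) ^ l F) ^ r) (π Q) * (fun G => (2 : ℝ≥0∞) ^ j G) (ρ Q)) := by
          rw [Finset.mul_sum]
          refine Finset.sum_congr rfl fun Q _ => ?_
          rw [ENNReal.mul_rpow_of_nonneg _ _ hr.le, ENNReal.mul_rpow_of_nonneg 2 _ hr.le]
          ring
      _ ≤ 2 ^ r * 2 * (B * K ^ r * Z * ((C * I) ^ (r / p) * (D * N) ^ (1 - r / q))) := by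
          refine mul_le_mul_right ((Hbil S k v σ ω Λσ Λω K h _ _ π ρ l j hπ hρ
            (fun F => ((2 : ℝ≥0∞) ^ l F) ^ r) (fun G => (2 : ℝ≥0∞) ^ j G)).trans ?_) _
          refine mul_le_mul_right (mul_le_mul' (ENNReal.rpow_le_rpow ?_ (by positivity))
            (ENNReal.rpow_le_rpow hsumg h1.le)) _
          refine le_trans (le_of_eq ?_) hsum
          refine Finset.sum_congr rfl fun F _ => ?_
          rw [← ENNReal.rpow_mul, mul_div_cancel₀ _ hr.ne']
      _ = _ := by
          rw [ENNReal.mul_rpow_of_nonneg _ _ (by positivity : 0 ≤ r / p),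
            ENNReal.mul_rpow_of_nonneg _ _ h1.le]
          ring
  have habs := rpow_le_of_le_mul_rpow hNt (by positivity : 0 < r / q) hmain
  have hr1 : 0 ≤ 1 / r := by positivity
  calc N ^ (1 / q) = (N ^ (r / q)) ^ (1 / r) := by
        rw [← ENNReal.rpow_mul, show r / q * (1 / r) = 1 / q by field_simp]
    _ ≤ (2 ^ r * 2 * B * C ^ (r / p) * D ^ (1 - r / q) * (K ^ r * Z * I ^ (r / p))) ^ (1 / r) :=
        ENNReal.rpow_le_rpow habs hr1
    _ = (2 ^ r * 2 * B * C ^ (r / p) * D ^ (1 - r / q)) ^ (1 / r) *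
          (K * Z ^ (1 / r) * I ^ (1 / p)) := by
        rw [ENNReal.mul_rpow_of_nonneg _ _ hr1, ENNReal.mul_rpow_of_nonneg (_ * _) (I ^ _) hr1,
          ENNReal.mul_rpow_of_nonneg _ Z hr1, ← ENNReal.rpow_mul I, ← ENNReal.rpow_mul K,
          mul_one_div_cancel hr.ne', ENNReal.rpow_one, show r / p * (1 / r) = 1 / p by field_simp]
    _ ≤ (2 ^ r * 2 * B * C ^ (r / p) * D ^ (1 - r / q)) ^ (1 / r) *
          (K * (2 ^ (1 / r) * (Λσ ^ (1 / q) + Λω ^ (1 / r - 1 / p))) * I ^ (1 / p)) := by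
        refine mul_le_mul_right (mul_le_mul_left (mul_le_mul_right ?_ _) _) _
        refine (add_rpow_le_mul_add_rpow _ _ hr1).trans (le_of_eq ?_)
        rw [← ENNReal.rpow_mul, ← ENNReal.rpow_mul, show r / q * (1 / r) = 1 / q by field_simp,
          show (1 - r / p) * (1 / r) = 1 / r - 1 / p by field_simp]
    _ = _ := by ring

/-- The two-weight estimate for a finite laminar family. -/
theorem exists_bound {p q r α n : ℝ} {Λ : ℝ≥0∞} (hn : 0 < n) (hα : 0 < α) (hα1 : α ≤ 1)
    (hΛ : Λ ≠ ⊤) (hp : 1 < p) (hpq : p ≤ q) (hr : 0 < r) (hexc : ¬(p = q ∧ r < q ∧ α < 1)) :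
    ∃ C : ℝ≥0∞, C ≠ ⊤ ∧ ∀ (S : Finset (Set X)) (k : Set X → ℤ) (v σ ω : Measure X)
      (Λσ Λω K : ℝ≥0∞), IsTwoWeight p q α n S k v σ ω Λ Λσ Λω K → ∀ f : X → ℝ≥0∞, Measurable f →
      (∀ Q ∈ S, ∫⁻ x in Q, f x ∂σ ≠ 0) → ∫⁻ x, f x ^ p ∂σ ≠ ⊤ →
      (∫⁻ x, (∑ Q ∈ S, Q.indicator (fun _ => (v Q ^ (-α) * ∫⁻ x in Q, f x ∂σ) ^ r) x) ^ (q / r) ∂ω)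
        ^ (1 / q) ≤ C * K * (Λσ ^ (1 / q) + Λω ^ max (1 / r - 1 / p) 0) *
          (∫⁻ x, f x ^ p ∂σ) ^ (1 / p) := by
  have hp0 : 0 < p := by linarith
  rcases le_or_gt q r with hqr | hrq
  · obtain ⟨C, hC, H⟩ := exists_bound_of_le (X := X) (α := α) (n := n) hp hpq hqr
    refine ⟨C, hC, fun S k v σ ω Λσ Λω K h f hf hf0 hft =>
      (H S k v σ ω Λ Λσ Λω K h f hf hf0 hft).trans ?_⟩
    gcongr
    exact le_self_add
  · have hcase : p < q ∨ α = 1 := by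
      by_contra! hcon
      exact hexc ⟨le_antisymm hpq hcon.1, hrq, lt_of_le_of_ne hα1 hcon.2⟩
    obtain ⟨θ, hθ⟩ := exists_isExponent hp hpq hr hrq hcase
    rcases le_or_gt p r with hpr | hrp
    · obtain ⟨C, hC, H⟩ := exists_bound_of_le_of_lt (X := X) hn hα hΛ hp hpr hrq hθ
      refine ⟨C, hC, fun S k v σ ω Λσ Λω K h f hf hf0 hft =>
        (H S k v σ ω Λσ Λω K h f hf hf0 hft).trans ?_⟩
      gcongr
      exact le_self_add
    · obtain ⟨C, hC, H⟩ := exists_bound_of_lt (X := X) hn hα hΛ hp hpq hr hrp hθ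
      have : 0 ≤ 1 / r - 1 / p := sub_nonneg.2 (one_div_le_one_div_of_le hr hrp.le)
      rw [max_eq_left this]
      exact ⟨C, hC, H⟩

end Main

section Dyadic

open Classical

variable {n : ℕ}

/-- The half-open cube with the same corner and side length as `Q`. -/
def halfOpen (Q : Cube n) : Set (Fin n → ℝ) :=
  Set.pi univ fun i => Ico (Q.corner i) (Q.corner i + Q.side)

theorem mem_halfOpen {Q : Cube n} {x : Fin n → ℝ} :
    x ∈ halfOpen Q ↔ ∀ i, Q.corner i ≤ x i ∧ x i < Q.corner i + Q.side := by
  simp [halfOpen]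

theorem measurableSet_halfOpen (Q : Cube n) : MeasurableSet (halfOpen Q) :=
  MeasurableSet.univ_pi fun _ => measurableSet_Ico

theorem corner_mem_halfOpen (Q : Cube n) : Q.corner ∈ halfOpen Q :=
  mem_halfOpen.2 fun _ => ⟨le_rfl, lt_add_of_pos_right _ Q.side_pos⟩

theorem halfOpen_subset_carrier (Q : Cube n) : halfOpen Q ⊆ Q.carrier := fun _ hx i =>
  ⟨(mem_halfOpen.1 hx i).1, (mem_halfOpen.1 hx i).2.le⟩

theorem carrier_eq_Icc (Q : Cube n) :
    Q.carrier = Icc Q.corner (fun i => Q.corner i + Q.side) := by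
  ext x
  simp [Cube.carrier, Pi.le_def, forall_and]

theorem isCompact_carrier (Q : Cube n) : IsCompact Q.carrier := by
  rw [carrier_eq_Icc]
  exact isCompact_Icc

theorem halfOpen_ae_eq (Q : Cube n) : halfOpen Q =ᵐ[volume] Q.carrier := by
  rw [carrier_eq_Icc]
  exact Measure.univ_pi_Ico_ae_eq_Icc

theorem volume_halfOpen (Q : Cube n) : volume (halfOpen Q) = ENNReal.ofReal Q.vol := by
  rw [halfOpen, Real.volume_pi_Ico]
  simp [Cube.vol, ENNReal.ofReal_pow Q.side_pos.le]

theorem vol_pos (Q : Cube n) : 0 < Q.vol := pow_pos Q.side_pos n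

/-- Dyadic half-open cubes meeting each other are nested, by the size of their sides. -/
theorem halfOpen_subset_of_mem {Q R : Cube n} (hQ : Q.IsDyadic) (hR : R.IsDyadic)
    {x : Fin n → ℝ} (hxQ : x ∈ halfOpen Q) (hxR : x ∈ halfOpen R) (h : Q.side ≤ R.side) :
    halfOpen Q ⊆ halfOpen R := by
  obtain ⟨j, m, hs, hc⟩ := hQ
  obtain ⟨j', m', hs', hc'⟩ := hR
  set δ : ℝ := (2 : ℝ) ^ (-j) with hδ
  have hδ0 : 0 < δ := by positivity
  have hj : j' ≤ j := by
    rw [hs, hs', hδ, zpow_le_zpow_iff_right₀ (by norm_num)] at h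
    omega
  obtain ⟨L, hL⟩ : ∃ L : ℤ, (2 : ℝ) ^ (-j') = L * δ := by
    refine ⟨2 ^ (j - j').toNat, ?_⟩
    push_cast
    rw [← zpow_natCast, Int.toNat_of_nonneg (by omega), hδ, ← zpow_add₀ (by norm_num)]
    congr 1
    ring
  intro y hy
  rw [mem_halfOpen] at hy hxQ hxR ⊢
  intro i
  obtain ⟨h1, h2⟩ := hxQ i
  obtain ⟨h3, h4⟩ := hxR i
  obtain ⟨h5, h6⟩ := hy i
  rw [hc, hs] at h2 h6
  rw [hc] at h1 h5
  rw [hc', hs', hL] at h4 ⊢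
  rw [hc', hL] at h3
  have h7 : m i < m' i * L + L := by
    have : (m i : ℝ) * δ < ((m' i * L + L : ℤ) : ℝ) * δ := by
      push_cast
      nlinarith
    exact_mod_cast lt_of_mul_lt_mul_right this hδ0.le
  have h8 : m' i * L < m i + 1 := by
    have : ((m' i * L : ℤ) : ℝ) * δ < ((m i + 1 : ℤ) : ℝ) * δ := by
      push_cast
      nlinarith
    exact_mod_cast lt_of_mul_lt_mul_right this hδ0.le
  have h9 : ((m' i * L : ℤ) : ℝ) * δ ≤ (m i : ℝ) * δ :=
    mul_le_mul_of_nonneg_right (by exact_mod_cast Int.lt_add_one_iff.1 h8) hδ0.le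
  have h10 : ((m i + 1 : ℤ) : ℝ) * δ ≤ ((m' i * L + L : ℤ) : ℝ) * δ :=
    mul_le_mul_of_nonneg_right (by exact_mod_cast Int.add_one_le_iff.2 h7) hδ0.le
  push_cast at h9 h10
  constructor <;> nlinarith

theorem side_le_of_volume_le (hn : 1 ≤ n) {Q R : Cube n}
    (h : volume (halfOpen Q) ≤ volume (halfOpen R)) : Q.side ≤ R.side := by
  rw [volume_halfOpen, volume_halfOpen, ENNReal.ofReal_le_ofReal_iff (vol_pos R).le] at h
  exact le_of_pow_le_pow_left₀ (by omega) R.side_pos.le h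

theorem side_le_of_subset (hn : 1 ≤ n) {Q R : Cube n} (h : halfOpen Q ⊆ halfOpen R) :
    Q.side ≤ R.side :=
  side_le_of_volume_le hn (measure_mono h)

theorem halfOpen_injective (hn : 1 ≤ n) : Function.Injective (halfOpen (n := n)) := by
  intro Q R h
  have hs : Q.side = R.side :=
    le_antisymm (side_le_of_subset hn h.subset) (side_le_of_subset hn h.superset)
  have hc : Q.corner = R.corner := by
    have h1 := mem_halfOpen.1 (h ▸ corner_mem_halfOpen Q)
    have h2 := mem_halfOpen.1 (h ▸ corner_mem_halfOpen R)
    exact funext fun i => le_antisymm (h2 i).1 (h1 i).1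
  obtain ⟨c, s, hs0⟩ := Q
  obtain ⟨c', s', hs0'⟩ := R
  simp only at hs hc
  subst hs hc
  rfl

theorem countable_isDyadic : {Q : Cube n | Q.IsDyadic}.Countable := by
  refine (countable_range fun a : ℤ × (Fin n → ℤ) =>
    (⟨fun i => a.2 i * (2 : ℝ) ^ (-a.1), (2 : ℝ) ^ (-a.1), by positivity⟩ : Cube n)).mono ?_
  rintro ⟨c, s, hs0⟩ ⟨j, m, hs, hc⟩
  refine ⟨(j, m), ?_⟩
  simp only at hs hc ⊢
  subst hs
  congr
  exact funext fun i => (hc i).symm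

/-- Finite families of dyadic cubes are laminar and scaled. -/
theorem exists_isScaled (hn : 1 ≤ n) (T : Finset (Cube n)) (hT : ∀ Q ∈ T, Q.IsDyadic) :
    ∃ k : Set (Fin n → ℝ) → ℤ, IsScaled (T.image halfOpen) k (n : ℝ) volume := by
  have hk : ∀ A : Set (Fin n → ℝ), ∃ k : ℤ, ∀ Q ∈ T, halfOpen Q = A → Q.side = (2 : ℝ) ^ k := by
    intro A
    by_cases hA : ∃ Q ∈ T, halfOpen Q = A
    · obtain ⟨Q, hQ, rfl⟩ := hA
      obtain ⟨j, m, hs, -⟩ := hT Q hQ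
      exact ⟨-j, fun R _ hR => by rw [halfOpen_injective hn hR, hs]⟩
    · exact ⟨0, fun Q hQ h => absurd ⟨Q, hQ, h⟩ hA⟩
  choose k hk using hk
  have hside : ∀ Q ∈ T, Q.side = (2 : ℝ) ^ k (halfOpen Q) := fun Q hQ => hk _ Q hQ rfl
  refine ⟨k, ⟨fun A hA => ?_, fun A hA B hB => ?_⟩, fun A hA => ?_, fun x A hA B hB hAB => ?_,
    fun A hA B hB hAB => ?_⟩
  · obtain ⟨Q, hQ, rfl⟩ := Finset.mem_image.1 hA
    exact measurableSet_halfOpen Q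
  · obtain ⟨Q, hQ, rfl⟩ := Finset.mem_image.1 hA
    obtain ⟨R, hR, rfl⟩ := Finset.mem_image.1 hB
    by_cases hd : Disjoint (halfOpen Q) (halfOpen R)
    · exact Or.inr (Or.inr hd)
    · obtain ⟨x, hxQ, hxR⟩ := Set.not_disjoint_iff.1 hd
      rcases le_total Q.side R.side with h | h
      · exact Or.inl (halfOpen_subset_of_mem (hT Q hQ) (hT R hR) hxQ hxR h)
      · exact Or.inr (Or.inl (halfOpen_subset_of_mem (hT R hR) (hT Q hQ) hxR hxQ h))
  · obtain ⟨Q, hQ, rfl⟩ := Finset.mem_image.1 hA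
    rw [volume_halfOpen, Cube.vol, ENNReal.rpow_natCast, ENNReal.ofReal_pow Q.side_pos.le,
      hside Q hQ, ← Real.rpow_intCast, ← ENNReal.ofReal_rpow_of_pos two_pos, ENNReal.rpow_intCast,
      ENNReal.ofReal_ofNat]
  · obtain ⟨Q, hQ, rfl⟩ := Finset.mem_image.1 hA.1
    obtain ⟨R, hR, rfl⟩ := Finset.mem_image.1 hB.1
    have hs : Q.side = R.side := by rw [hside Q hQ, hside R hR, hAB]
    exact subset_antisymm (halfOpen_subset_of_mem (hT Q hQ) (hT R hR) hA.2 hB.2 hs.le)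
      (halfOpen_subset_of_mem (hT R hR) (hT Q hQ) hB.2 hA.2 hs.ge)
  · obtain ⟨Q, hQ, rfl⟩ := Finset.mem_image.1 hA
    obtain ⟨R, hR, rfl⟩ := Finset.mem_image.1 hB
    have := side_le_of_subset hn hAB
    rwa [hside Q hQ, hside R hR, zpow_le_zpow_iff_right₀ (by norm_num)] at this

/-- The measure with density `w`. -/
def weightMeasure (w : (Fin n → ℝ) → ℝ) : Measure (Fin n → ℝ) :=
  volume.withDensity fun x => ENNReal.ofReal (w x)

theorem weightMeasure_halfOpen (w : (Fin n → ℝ) → ℝ) (Q : Cube n) :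
    weightMeasure w (halfOpen Q) = wMass w Q := by
  rw [weightMeasure, withDensity_apply _ (measurableSet_halfOpen Q), wMass,
    setLIntegral_congr (halfOpen_ae_eq Q)]

theorem wMass_ne_top {w : (Fin n → ℝ) → ℝ} (hw : IsWeight w) (Q : Cube n) : wMass w Q ≠ ⊤ := by
  have := hw.1.integrableOn_isCompact (isCompact_carrier Q)
  exact this.lintegral_lt_top.ne

theorem aemeasurable_ofReal_weight {w : (Fin n → ℝ) → ℝ} (hw : IsWeight w) :
    AEMeasurable (fun x => ENNReal.ofReal (w x)) volume :=
  hw.1.aestronglyMeasurable.aemeasurable.ennreal_ofReal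

theorem exists_disjoint_of_isSparse {η : ℝ} {S : Set (Cube n)} (hS : IsSparse η S) :
    ∃ E : Cube n → Set (Fin n → ℝ), (∀ Q ∈ S, MeasurableSet (E Q)) ∧
      (∀ Q ∈ S, E Q ⊆ halfOpen Q) ∧ S.PairwiseDisjoint E ∧
      ∀ Q ∈ S, ENNReal.ofReal η * volume (halfOpen Q) ≤ volume (E Q) := by
  obtain ⟨E, hm, hsub, hd, hle⟩ := hS
  refine ⟨fun Q => E Q ∩ halfOpen Q, fun Q hQ => (hm Q hQ).inter (measurableSet_halfOpen Q),
    fun Q _ => inter_subset_right, fun Q hQ R hR hne => ?_, fun Q hQ => ?_⟩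
  · exact (hd hQ hR hne).mono inter_subset_left inter_subset_left
  · rw [volume_halfOpen, ← ENNReal.ofReal_mul' (vol_pos Q).le]
    refine (hle Q hQ).trans (le_of_eq (measure_congr ?_))
    have := (Filter.EventuallyEq.refl (ae volume) (E Q)).inter (halfOpen_ae_eq Q)
    rw [inter_eq_self_of_subset_left (hsub Q hQ)] at this
    exact this.symm

/-- The packing estimate for a sparse family: masses controlled on each cube by the average of
`g` over the cube are controlled in total by the integral of `g`. -/
theorem sum_le_lintegral_of_isSparse {η : ℝ} (hη : 0 < η) {S : Set (Cube n)}
    (hS : IsSparse η S) (T : Finset (Cube n)) (hT : ∀ Q ∈ T, Q ∈ S) (A : Set (Fin n → ℝ))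
    (hA : ∀ Q ∈ T, halfOpen Q ⊆ A) (b : Cube n → ℝ≥0∞) (g : (Fin n → ℝ) → ℝ≥0∞)
    (hg : ∀ Q ∈ T, ∀ x ∈ halfOpen Q, b Q ≤ volume (halfOpen Q) * g x) :
    ∑ Q ∈ T, b Q ≤ (ENNReal.ofReal η)⁻¹ * ∫⁻ x in A, g x := by
  obtain ⟨E, hm, hsub, hd, hle⟩ := exists_disjoint_of_isSparse hS
  have hη0 : ENNReal.ofReal η ≠ 0 := (ENNReal.ofReal_pos.2 hη).ne'
  have hv0 : ∀ Q : Cube n, volume (halfOpen Q) ≠ 0 := fun Q => by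
    rw [volume_halfOpen]
    exact (ENNReal.ofReal_pos.2 (vol_pos Q)).ne'
  have hvt : ∀ Q : Cube n, volume (halfOpen Q) ≠ ⊤ := fun Q => by
    rw [volume_halfOpen]
    exact ENNReal.ofReal_ne_top
  calc ∑ Q ∈ T, b Q ≤ ∑ Q ∈ T, (ENNReal.ofReal η)⁻¹ * ∫⁻ x in E Q, g x := by
        refine Finset.sum_le_sum fun Q hQ => ?_
        rw [← ENNReal.mul_le_iff_le_inv hη0 ENNReal.ofReal_ne_top]
        calc ENNReal.ofReal η * b Q
            = ENNReal.ofReal η * volume (halfOpen Q) * (b Q / volume (halfOpen Q)) := by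
              rw [mul_assoc, ENNReal.mul_div_cancel (hv0 Q) (hvt Q)]
          _ ≤ volume (E Q) * (b Q / volume (halfOpen Q)) := by
              gcongr
              exact hle Q (hT Q hQ)
          _ = ∫⁻ x in E Q, b Q / volume (halfOpen Q) := by rw [setLIntegral_const, mul_comm]
          _ ≤ _ := by
              refine setLIntegral_mono' (hm Q (hT Q hQ)) fun x hx => ?_
              rw [ENNReal.div_le_iff (hv0 Q) (hvt Q), mul_comm]
              exact hg Q hQ x (hsub Q (hT Q hQ) hx)
    _ = (ENNReal.ofReal η)⁻¹ * ∫⁻ x in ⋃ Q ∈ T, E Q, g x := by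
        rw [← Finset.mul_sum, lintegral_biUnion_finset (hd.subset hT)
          fun Q hQ => hm Q (hT Q hQ)]
    _ ≤ _ := by
        gcongr
        exact iUnion₂_subset fun Q hQ => (hsub Q (hT Q hQ)).trans (hA Q hQ)

theorem isCarleson_image (hn : 1 ≤ n) (T : Finset (Cube n)) (μ : Measure (Fin n → ℝ)) (Λ : ℝ≥0∞)
    (h0 : ∀ Q ∈ T, μ (halfOpen Q) ≠ 0) (ht : ∀ Q ∈ T, μ (halfOpen Q) ≠ ⊤)
    (h : ∀ R ∈ T, ∑ Q ∈ T with halfOpen Q ⊆ halfOpen R, μ (halfOpen Q) ≤ Λ * μ (halfOpen R)) :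
    IsCarleson (T.image halfOpen) μ Λ := by
  refine ⟨fun A hA => ?_, fun A hA => ?_, fun A hA => ?_⟩ <;>
    obtain ⟨R, hR, rfl⟩ := Finset.mem_image.1 hA
  · exact h0 R hR
  · exact ht R hR
  · rw [Finset.filter_image, Finset.sum_image fun Q _ Q' _ h => halfOpen_injective hn h]
    exact h R hR

theorem isCarleson_volume (hn : 1 ≤ n) {η : ℝ} (hη : 0 < η) {S : Set (Cube n)}
    (hS : IsSparse η S) (T : Finset (Cube n)) (hT : ∀ Q ∈ T, Q ∈ S) :
    IsCarleson (T.image halfOpen) volume (ENNReal.ofReal η)⁻¹ := by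
  refine isCarleson_image hn T _ _ (fun Q _ => ?_) (fun Q _ => ?_) fun R _ => ?_
  · rw [volume_halfOpen]
    exact (ENNReal.ofReal_pos.2 (vol_pos Q)).ne'
  · rw [volume_halfOpen]
    exact ENNReal.ofReal_ne_top
  · refine (sum_le_lintegral_of_isSparse hη hS _ (fun Q hQ => hT Q (Finset.mem_filter.1 hQ).1)
      (halfOpen R) (fun Q hQ => (Finset.mem_filter.1 hQ).2) _ (fun _ => 1) fun Q _ x _ => ?_).trans
      (le_of_eq ?_)
    · rw [mul_one]
    · rw [setLIntegral_one]

theorem isCarleson_weightMeasure (hn : 1 ≤ n) {η : ℝ} (hη : 0 < η) {S : Set (Cube n)}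
    (hS : IsSparse η S) {w : (Fin n → ℝ) → ℝ} (hw : IsWeight w) (T : Finset (Cube n))
    (hT : ∀ Q ∈ T, Q ∈ S) (h0 : ∀ Q ∈ T, wMass w Q ≠ 0) :
    IsCarleson (T.image halfOpen) (weightMeasure w) ((ENNReal.ofReal η)⁻¹ * AinfChar w) := by
  refine isCarleson_image hn T _ _ (fun Q hQ => ?_) (fun Q _ => ?_) fun R hR => ?_
  · rw [weightMeasure_halfOpen]
    exact h0 Q hQ
  · rw [weightMeasure_halfOpen]
    exact wMass_ne_top hw Q
  · calc _ ≤ (ENNReal.ofReal η)⁻¹ *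
          ∫⁻ x in R.carrier, maximal (R.carrier.indicator w) x := by
          refine sum_le_lintegral_of_isSparse hη hS _
            (fun Q hQ => hT Q (Finset.mem_filter.1 hQ).1) R.carrier
            (fun Q hQ => (Finset.mem_filter.1 hQ).2.trans (halfOpen_subset_carrier R)) _ _
            fun Q hQ x hx => ?_
          have hsub := (Finset.mem_filter.1 hQ).2.trans (halfOpen_subset_carrier R)
          have hmax := le_iSup₂_of_le (f := fun (Q : Cube n) (_ : x ∈ Q.carrier) =>
            (ENNReal.ofReal Q.vol)⁻¹ *
              ∫⁻ y in Q.carrier, ENNReal.ofReal |R.carrier.indicator w y|) Q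
            (halfOpen_subset_carrier Q hx) le_rfl
          rw [volume_halfOpen, ← ENNReal.inv_mul_le_iff
            (ENNReal.ofReal_pos.2 (vol_pos Q)).ne' ENNReal.ofReal_ne_top]
          refine le_trans (le_of_eq ?_) hmax
          congr 1
          rw [weightMeasure, withDensity_apply _ (measurableSet_halfOpen Q),
            ← setLIntegral_congr (halfOpen_ae_eq Q)]
          refine setLIntegral_congr_fun (measurableSet_halfOpen Q) fun y hy => ?_
          rw [Set.indicator_of_mem (hsub hy), abs_of_nonneg (hw.2 y)]
      _ ≤ (ENNReal.ofReal η)⁻¹ * (wMass w R * AinfChar w) := by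
          gcongr
          rw [← ENNReal.inv_mul_le_iff (h0 R hR) (wMass_ne_top hw R)]
          exact le_iSup (fun Q : Cube n => (wMass w Q)⁻¹ *
            ∫⁻ x in Q.carrier, maximal (Q.carrier.indicator w) x) R
      _ = _ := by
          rw [weightMeasure_halfOpen]
          ring

end Dyadic

section Euclidean

variable {n : ℕ}

theorem measurable_sum_indicator_carrier (T : Finset (Cube n)) (g : Cube n → ℝ≥0∞) :
    Measurable fun x => ∑ Q ∈ T, Q.carrier.indicator (fun _ => g Q) x :=
  Finset.measurable_sum _ fun Q _ =>
    measurable_const.indicator (isCompact_carrier Q).isClosed.measurableSet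

/-- The sum over closed cubes agrees almost everywhere with the sum over those half-open cubes
that do not carry a vanishing term. -/
theorem sum_indicator_ae_eq (hn : 1 ≤ n) (w : (Fin n → ℝ) → ℝ) (T : Finset (Cube n))
    (P : Cube n → Prop) [DecidablePred P] (g : Set (Fin n → ℝ) → ℝ≥0∞)
    (hP : ∀ Q ∈ T, ¬P Q → wMass w Q = 0 ∨ g (halfOpen Q) = 0) :
    (fun x => ∑ Q ∈ T, Q.carrier.indicator (fun _ => g (halfOpen Q)) x) =ᵐ[weightMeasure w]
      fun x => ∑ A ∈ (T.filter P).image halfOpen, A.indicator (fun _ => g A) x := by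
  have h1 : ∀ᵐ x ∂weightMeasure w, ∀ Q ∈ T, (x ∈ halfOpen Q ↔ x ∈ Q.carrier) := by
    rw [Finset.eventually_all]
    intro Q _
    filter_upwards [(withDensity_absolutelyContinuous volume _).ae_eq (halfOpen_ae_eq Q)]
      with x hx using iff_of_eq hx
  have h2 : ∀ᵐ x ∂weightMeasure w, ∀ Q ∈ T, wMass w Q = 0 → x ∉ halfOpen Q := by
    rw [Finset.eventually_all]
    intro Q _
    by_cases h : wMass w Q = 0
    · rw [← weightMeasure_halfOpen] at h
      filter_upwards [measure_eq_zero_iff_ae_notMem.1 h] with x hx _ using hx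
    · exact Filter.Eventually.of_forall fun x h' => absurd h' h
  filter_upwards [h1, h2] with x h1 h2
  rw [Finset.sum_image fun Q _ Q' _ h => halfOpen_injective hn h, Finset.sum_filter]
  refine Finset.sum_congr rfl fun Q hQ => ?_
  have h3 : Q.carrier.indicator (fun _ => g (halfOpen Q)) x =
      (halfOpen Q).indicator (fun _ => g (halfOpen Q)) x := by
    by_cases hx : x ∈ halfOpen Q
    · rw [indicator_of_mem hx, indicator_of_mem ((h1 Q hQ).1 hx)]
    · rw [indicator_of_notMem hx, indicator_of_notMem fun h => hx ((h1 Q hQ).2 h)]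
  rw [h3]
  split_ifs with h
  · rfl
  · rcases hP Q hQ h with h0 | h0
    · exact indicator_of_notMem (h2 Q hQ h0) _
    · rw [h0]
      simp

theorem setLIntegral_weightMeasure {w f : (Fin n → ℝ) → ℝ} (hw : IsWeight w) (hf : Measurable f)
    (Q : Cube n) : ∫⁻ x in halfOpen Q, ENNReal.ofReal (f x) ∂weightMeasure w =
      ∫⁻ x in Q.carrier, ENNReal.ofReal (f x * w x) := by
  rw [weightMeasure, setLIntegral_withDensity_eq_lintegral_mul₀ (aemeasurable_ofReal_weight hw)
    hf.ennreal_ofReal.aemeasurable (measurableSet_halfOpen Q), setLIntegral_congr (halfOpen_ae_eq Q)]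
  refine lintegral_congr fun x => ?_
  rw [Pi.mul_apply, ENNReal.ofReal_mul' (hw.2 x), mul_comm]

theorem lintegral_ofReal_rpow_le {p : ℝ} (hp : 0 < p) {w f : (Fin n → ℝ) → ℝ} (hw : IsWeight w)
    (hf : Measurable f) : (∫⁻ x, ENNReal.ofReal (f x) ^ p ∂weightMeasure w) ^ (1 / p) ≤
      wNorm p w f := by
  rw [weightMeasure, lintegral_withDensity_eq_lintegral_mul₀ (aemeasurable_ofReal_weight hw)
    (hf.ennreal_ofReal.pow_const p).aemeasurable, wNorm]
  refine ENNReal.rpow_le_rpow (lintegral_mono fun x => ?_) (by positivity)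
  rw [Pi.mul_apply, mul_comm, ← ENNReal.ofReal_rpow_of_nonneg (abs_nonneg _) hp.le]
  exact mul_le_mul_left (ENNReal.rpow_le_rpow (ENNReal.ofReal_le_ofReal (le_abs_self _)) hp.le) _

/-- The operator norm bound for finite sparse families. -/
theorem exists_bound_finset (hn : 1 ≤ n) {p q r α η : ℝ} (hp : 1 < p) (hpq : p ≤ q) (hr : 0 < r)
    (hα : 0 < α) (hα1 : α ≤ 1) (hη : 0 < η) (hexc : ¬(p = q ∧ r < q ∧ α < 1)) :
    ∃ C : ℝ≥0∞, C ≠ ⊤ ∧ ∀ S : Set (Cube n), (∀ Q ∈ S, Q.IsDyadic) → IsSparse η S →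
      ∀ ω σ' : (Fin n → ℝ) → ℝ, IsWeight ω → IsWeight σ' → twoWeightChar p q α S ω σ' < ∞ →
        ∀ f : (Fin n → ℝ) → ℝ, Measurable f → wNorm p σ' f < ∞ →
        ∀ T : Finset (Cube n), (∀ Q ∈ T, Q ∈ S) →
          (∫⁻ x, (∑ Q ∈ T, Q.carrier.indicator (fun _ => ((ENNReal.ofReal Q.vol) ^ (-α) *
            ∫⁻ y in Q.carrier, ENNReal.ofReal (f y * σ' y)) ^ r) x) ^ (q / r) ∂weightMeasure ω)
              ^ (1 / q) ≤ C * twoWeightChar p q α S ω σ' *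
              (AinfChar σ' ^ (1 / q) + AinfChar ω ^ max (1 / r - 1 / p) 0) * wNorm p σ' f := by
  classical
  have hp0 : 0 < p := by linarith
  have hq0 : 0 < q := by linarith
  have hn0 : (0 : ℝ) < n := by exact_mod_cast hn
  set b : ℝ≥0∞ := (ENNReal.ofReal η)⁻¹ with hb
  have hbt : b ≠ ⊤ := ENNReal.inv_ne_top.2 (ENNReal.ofReal_pos.2 hη).ne'
  set m := max (1 / r - 1 / p) 0 with hm
  have hm0 : 0 ≤ m := le_max_right _ _
  obtain ⟨C, hC, H⟩ := exists_bound (X := Fin n → ℝ) hn0 hα hα1 hbt hp hpq hr hexc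
  refine ⟨C * (b ^ (1 / q) + b ^ m), by finiteness, ?_⟩
  intro S hdy hS ω σ' hω hσ hK f hf hft T hT
  set F : (Fin n → ℝ) → ℝ≥0∞ := fun x => ENNReal.ofReal (f x) with hF
  set g : Set (Fin n → ℝ) → ℝ≥0∞ := fun A =>
    (volume A ^ (-α) * ∫⁻ x in A, F x ∂weightMeasure σ') ^ r with hg
  let P : Cube n → Prop := fun Q =>
    wMass ω Q ≠ 0 ∧ ∫⁻ x in halfOpen Q, F x ∂weightMeasure σ' ≠ 0
  have hle := lintegral_ofReal_rpow_le hp0 hσ hf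
  have hσ0 : ∀ Q, P Q → wMass σ' Q ≠ 0 := fun Q hQ h0 => hQ.2 <| by
    rw [← weightMeasure_halfOpen] at h0
    exact setLIntegral_measure_zero _ _ h0
  have hTP : ∀ Q ∈ T.filter P, Q ∈ S := fun Q hQ => hT Q (Finset.mem_filter.1 hQ).1
  have hPP : ∀ Q ∈ T.filter P, P Q := fun Q hQ => (Finset.mem_filter.1 hQ).2
  obtain ⟨k, hk⟩ := exists_isScaled hn (T.filter P) fun Q hQ => hdy Q (hTP Q hQ)
  have htw : IsTwoWeight p q α n ((T.filter P).image halfOpen) k volume (weightMeasure σ')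
      (weightMeasure ω) b (b * AinfChar σ') (b * AinfChar ω) (twoWeightChar p q α S ω σ') := by
    refine ⟨hk, isCarleson_volume hn hη hS _ hTP,
      isCarleson_weightMeasure hn hη hS hσ _ hTP fun Q hQ => hσ0 Q (hPP Q hQ),
      isCarleson_weightMeasure hn hη hS hω _ hTP fun Q hQ => (hPP Q hQ).1, hK.ne, fun A hA => ?_⟩
    obtain ⟨Q, hQ, rfl⟩ := Finset.mem_image.1 hA
    rw [volume_halfOpen, weightMeasure_halfOpen, weightMeasure_halfOpen]
    exact le_iSup₂_of_le (f := fun (Q : Cube n) (_ : Q ∈ S) => (ENNReal.ofReal Q.vol) ^ (-α) *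
      wMass ω Q ^ (1 / q) * wMass σ' Q ^ (1 - 1 / p)) Q (hTP Q hQ) le_rfl
  have hfin : ∫⁻ x, F x ^ p ∂weightMeasure σ' ≠ ⊤ := fun h => by
    rw [h, ENNReal.top_rpow_of_pos (by positivity)] at hle
    exact hft.ne (top_le_iff.1 hle)
  have key := H _ k _ _ _ _ _ _ htw F hf.ennreal_ofReal (fun A hA => by
    obtain ⟨Q, hQ, rfl⟩ := Finset.mem_image.1 hA
    exact (hPP Q hQ).2) hfin
  have hsum := sum_indicator_ae_eq hn ω T P g fun Q _ hQ => by
    by_cases h0 : wMass ω Q = 0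
    · exact Or.inl h0
    · have : ∫⁻ x in halfOpen Q, F x ∂weightMeasure σ' = 0 := by
        by_contra h
        exact hQ ⟨h0, h⟩
      right
      rw [hg]
      simp only
      rw [this, mul_zero, ENNReal.zero_rpow_of_pos hr]
  have hgQ : ∀ Q : Cube n, g (halfOpen Q) = ((ENNReal.ofReal Q.vol) ^ (-α) *
      ∫⁻ y in Q.carrier, ENNReal.ofReal (f y * σ' y)) ^ r := fun Q => by
    rw [hg]
    simp only
    rw [hF, setLIntegral_weightMeasure hσ hf, volume_halfOpen]
  simp only [hgQ] at hsum
  have hint := lintegral_congr_ae (hsum.fun_comp (· ^ (q / r)))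
  simp only [Function.comp_apply] at hint
  rw [hint]
  refine key.trans ?_
  have hconst : (b * AinfChar σ') ^ (1 / q) + (b * AinfChar ω) ^ m ≤
      (b ^ (1 / q) + b ^ m) * (AinfChar σ' ^ (1 / q) + AinfChar ω ^ m) := by
    rw [ENNReal.mul_rpow_of_nonneg _ _ (by positivity), ENNReal.mul_rpow_of_nonneg _ _ hm0, mul_add]
    exact add_le_add (mul_le_mul_left le_self_add _) (mul_le_mul_left le_add_self _)
  calc _ ≤ C * twoWeightChar p q α S ω σ' *
        ((b ^ (1 / q) + b ^ m) * (AinfChar σ' ^ (1 / q) + AinfChar ω ^ m)) * wNorm p σ' f :=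
        mul_le_mul' (mul_le_mul_right hconst _) hle
    _ = _ := by ring

theorem eNorm_sparseOp_le {q r α : ℝ} (hq : 0 < q) (hr : 0 < r) {S : Set (Cube n)}
    (hS : ∀ Q ∈ S, Q.IsDyadic) {w : (Fin n → ℝ) → ℝ} (hw : IsWeight w) (h : (Fin n → ℝ) → ℝ)
    {K : ℝ≥0∞} (hK : ∀ T : Finset (Cube n), (∀ Q ∈ T, Q ∈ S) →
      (∫⁻ x, (∑ Q ∈ T, Q.carrier.indicator (fun _ => ((ENNReal.ofReal Q.vol) ^ (-α) *
        ∫⁻ y in Q.carrier, ENNReal.ofReal (h y)) ^ r) x) ^ (q / r) ∂weightMeasure w) ^ (1 / q) ≤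
          K) : eNorm q w (sparseOp S r α h) ≤ K := by
  classical
  set g : Cube n → ℝ≥0∞ := fun Q =>
    ((ENNReal.ofReal Q.vol) ^ (-α) * ∫⁻ y in Q.carrier, ENNReal.ofReal (h y)) ^ r with hg
  have hqr : 0 < q / r := by positivity
  let G : Finset S → (Fin n → ℝ) → ℝ≥0∞ := fun T x =>
    (∑ Q ∈ T.map (Function.Embedding.subtype _), Q.carrier.indicator (fun _ => g Q) x) ^ (q / r)
  have hGm : ∀ T, Measurable (G T) := fun T => (measurable_sum_indicator_carrier _ g).pow_const _
  have hpt : ∀ x, sparseOp S r α h x ^ q = ⨆ T, G T x := fun x => by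
    rw [sparseOp, ← ENNReal.rpow_mul, one_div_mul_eq_div, cubeSum, ENNReal.tsum_eq_iSup_sum]
    refine ((ENNReal.orderIsoRpow (q / r) hqr).map_iSup _).trans (iSup_congr fun T => ?_)
    simp only [G, Finset.sum_map]
    rfl
  have : Countable S := (countable_isDyadic.mono hS).to_subtype
  have hmono : Monotone G := fun T T' hTT' x =>
    ENNReal.rpow_le_rpow (Finset.sum_le_sum_of_subset (Finset.map_subset_map.2 hTT')) hqr.le
  have hint : ∫⁻ x, sparseOp S r α h x ^ q * ENNReal.ofReal (w x) =
      ⨆ T, ∫⁻ x, G T x ∂weightMeasure w := by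
    rw [← lintegral_iSup_directed (fun T => (hGm T).aemeasurable) hmono.directed_le, weightMeasure,
      lintegral_withDensity_eq_lintegral_mul₀ (aemeasurable_ofReal_weight hw)
        (Measurable.iSup hGm).aemeasurable]
    exact lintegral_congr fun x => by rw [hpt, Pi.mul_apply, mul_comm]
  rw [eNorm, hint, one_div, ENNReal.rpow_inv_le_iff hq]
  refine iSup_le fun T => ?_
  rw [← ENNReal.rpow_inv_le_iff hq, ← one_div]
  refine hK _ fun Q hQ => ?_
  obtain ⟨Q', -, rfl⟩ := Finset.mem_map.1 hQ
  exact Q'.2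

end Euclidean

end SparseBound

/-- the main two-weight `A_{pq}`–`A∞` estimate for sparse operators, in all
cases except the exceptional diagonal case `p = q > r`, `α < 1`. -/
theorem stmt1 (n : ℕ) (hn : 1 ≤ n) (p q r α η : ℝ)
    (hp : 1 < p) (hpq : p ≤ q) (hr : 0 < r) (hα : 0 < α) (hα1 : α ≤ 1)
    (hη : 0 < η) (hη1 : η ≤ 1)
    (hexc : ¬(p = q ∧ r < q ∧ α < 1)) :
    ∃ C : ℝ, 0 < C ∧
      ∀ (S : Set (Cube n)), (∀ Q ∈ S, Q.IsDyadic) → IsSparse η S →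
      ∀ ω σ' : (Fin n → ℝ) → ℝ, IsWeight ω → IsWeight σ' →
        AinfChar ω < ∞ → AinfChar σ' < ∞ → twoWeightChar p q α S ω σ' < ∞ →
        ∀ f : (Fin n → ℝ) → ℝ, Measurable f → wNorm p σ' f < ∞ →
          eNorm q ω (sparseOp S r α (fun y => f y * σ' y)) ≤
            ENNReal.ofReal C * twoWeightChar p q α S ω σ' *
              (AinfChar σ' ^ (1 / q) + AinfChar ω ^ max (1 / r - 1 / p) 0) *
              wNorm p σ' f := by
  obtain ⟨C, hC, H⟩ := SparseBound.exists_bound_finset hn hp hpq hr hα hα1 hη hexc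
  have hC1 : C ≤ ENNReal.ofReal (C.toReal + 1) :=
    (ENNReal.ofReal_toReal hC).symm.le.trans (ENNReal.ofReal_le_ofReal (by linarith))
  refine ⟨C.toReal + 1, by positivity, fun S hdy hS ω σ' hω hσ _ _ hK f hf hft => ?_⟩
  refine (SparseBound.eNorm_sparseOp_le (by linarith) hr hdy hω _
    (H S hdy hS ω σ' hω hσ hK f hf hft)).trans ?_
  gcongr
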